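/- arXiv:0804.4847 — 6 statements merged into one kernel-verified Lean document; each statement's English description precedes it below -/
import Mathlib

section
/- For every ε > 0 and every integer m ≥ 3 there exists δ > 0 (depending only on ε and m) such that the following holds. Let G be a finite abelian group of order N and let A₁, …, A_m be subsets of G. If the number of m-tuples (a₁, …, a_m) with aᵢ ∈ Aᵢ for all i and a₁ + a₂ + ⋯ + a_m = 0 is at most δ·N^{m-1}, then there exist subsets A′ᵢ ⊆ Aᵢ with |Aᵢ \ A′ᵢ| ≤ ε·N for every i, such that there is no m-tuple (a′₁, …, a′_m) with a′ᵢ ∈ A′ᵢ for all i and a′₁ + a′₂ + ⋯ + a′_m = 0. -/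
open Finset

open scoped Classical in
/-- Any two subsets of `X` and `Y` of sizes at least `σ * p` and `σ * q` span at least a proportion
`ρ` of the possible `r`-edges. -/
def IsLowerRegular {V : Type*} (r : V → V → Prop) (ρ σ p q : ℝ) (X Y : Finset V) : Prop :=
  ∀ S ⊆ X, ∀ T ⊆ Y, σ * p ≤ #S → σ * q ≤ #T → ρ * #S * #T ≤ #(Rel.interedges r S T)

namespace IsLowerRegular

variable {V : Type*} {r : V → V → Prop} {ρ σ p q : ℝ} {X Y S T : Finset V}

open scoped Classical in
lemma flip (h : IsLowerRegular r ρ σ p q X Y) : IsLowerRegular (flip r) ρ σ q p Y X := by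
  intro T hT S hS hT' hS'
  have := h S hS T hT hS' hT'
  have e : #(Rel.interedges (_root_.flip r) T S) = #(Rel.interedges r S T) := by
    refine card_bij (fun x _ ↦ x.swap) ?_ ?_ ?_
    · simp [Rel.mem_interedges_iff, _root_.flip]
      tauto
    · simp
    · rintro ⟨a, b⟩ hab
      refine ⟨(b, a), ?_, rfl⟩
      simp only [Rel.mem_interedges_iff, _root_.flip] at hab ⊢
      tauto
  rw [e]
  linarith

open scoped Classical in
/-- Few vertices of `Y` have few neighbours in a large subset `S` of `X`. -/
lemma card_lowDegree_lt (h : IsLowerRegular r ρ σ p q X Y) (hσ : 0 < σ) (hq : 0 < q)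
    (hS : S ⊆ X) (hS' : σ * p ≤ #S) :
    (#{y ∈ Y | #{x ∈ S | r x y} < ρ * #S} : ℝ) < σ * q := by
  by_contra! hlt
  set B := {y ∈ Y | #{x ∈ S | r x y} < ρ * #S} with hB
  have h1 := h S hS B (filter_subset _ _) hS' hlt
  have hne : B.Nonempty := by
    rw [← card_pos]
    exact_mod_cast (mul_pos hσ hq).trans_le hlt
  have h2 : #(Rel.interedges r S B) = ∑ y ∈ B, #{x ∈ S | r x y} := by
    simp only [Rel.interedges, card_filter, sum_product_right]
  have h3 : (∑ y ∈ B, #{x ∈ S | r x y} : ℝ) < ∑ y ∈ B, ρ * #S :=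
    sum_lt_sum_of_nonempty hne fun y hy ↦ (mem_filter.1 hy).2
  rw [h2] at h1
  push_cast at h1
  rw [sum_const, nsmul_eq_mul] at h3
  linarith

end IsLowerRegular

open scoped Classical in
/-- Counting lemma for paths between two large sets in a chain of lower regular pairs. -/
lemma path_counting {V : Type*} [Fintype V] {ρ σ τ : ℝ} (hρ : 0 < ρ) (hσ : 0 < σ)
    (hτ : 2 * σ ≤ τ) (k : ℕ) :
    ∀ (R : Fin (k + 1) → V → V → Prop) (X : Fin (k + 2) → Finset V) (p : Fin (k + 2) → ℝ)
      (S T : Finset V), (∀ i, 0 < p i) → (∀ i, τ * p i ≤ #(X i)) →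
      (∀ i, IsLowerRegular (R i) ρ σ (p i.castSucc) (p i.succ) (X i.castSucc) (X i.succ)) →
      S ⊆ X 0 → T ⊆ X (Fin.last _) → σ * p 0 ≤ #S → σ * p (Fin.last _) ≤ #T →
      (ρ * σ) ^ k * (ρ * σ ^ 2) * ∏ i, p i ≤
        #{x : Fin (k + 2) → V | x 0 ∈ S ∧ x (Fin.last _) ∈ T ∧
          ∀ i : Fin (k + 1), R i (x i.castSucc) (x i.succ)} := by
  induction k with
  | zero =>
    intro R X p S T hp hX hR hS hT hS' hT'
    have h := hR 0 S hS T hT hS' hT'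
    have e : #(Rel.interedges (R 0) S T) ≤ #{x : Fin 2 → V | x 0 ∈ S ∧ x (Fin.last _) ∈ T ∧
          ∀ i : Fin 1, R i (x i.castSucc) (x i.succ)} := by
      refine card_le_card_of_injOn (fun x ↦ ![x.1, x.2]) ?_ ?_
      · rintro ⟨a, b⟩ hab
        simpa [Rel.mem_interedges_iff, Fin.forall_fin_one] using hab
      · rintro ⟨a, b⟩ - ⟨c, d⟩ - hx
        have h0 := congrFun hx 0
        have h1 := congrFun hx 1
        simp at h0 h1
        simp [h0, h1]
    have e' : (#(Rel.interedges (R 0) S T) : ℝ) ≤ _ := Nat.cast_le.2 e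
    refine le_trans ?_ (h.trans e')
    rw [Fin.prod_univ_two]
    have h0 := hp 0
    calc _ = ρ * (σ * p 0) * (σ * p (Fin.last _)) := by
          simp only [Fin.last, Nat.reduceAdd, Fin.mk_one]; ring
      _ ≤ _ := by
        have h1 := hp (Fin.last _)
        gcongr
  | succ k ih =>
    intro R X p S T hp hX hR hS hT hS' hT'
    set S' := {y ∈ X 1 | ρ * #S ≤ #{x ∈ S | R 0 x y}} with hS'_def
    have hlow := (hR 0).card_lowDegree_lt hσ (hp _) hS hS'
    have hcard : #{y ∈ X 1 | #{x ∈ S | R 0 x y} < ρ * #S} + #S' = #(X 1) := by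
      rw [hS'_def, ← card_filter_add_card_filter_not (s := X 1)
        (fun y ↦ #{x ∈ S | R 0 x y} < ρ * #S)]
      simp only [not_lt]
    have hcard' : (#{y ∈ X 1 | #{x ∈ S | R 0 x y} < ρ * #S} : ℝ) + #S' = #(X 1) := by
      exact_mod_cast hcard
    have hS'card : σ * p 1 ≤ #S' := by
      have := hX 1
      have hlow' : (#{y ∈ X 1 | #{x ∈ S | R 0 x y} < ρ * #S} : ℝ) < σ * p 1 := hlow
      nlinarith [hp 1]
    have key := ih (fun i ↦ R i.succ) (fun i ↦ X i.succ) (fun i ↦ p i.succ) S' T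
      (fun i ↦ hp _) (fun i ↦ hX _) (fun i ↦ hR i.succ) (filter_subset _ _) hT hS'card hT'
    set Q : Finset (Fin (k + 2) → V) := {x | x 0 ∈ S' ∧ x (Fin.last _) ∈ T ∧
      ∀ i : Fin (k + 1), R i.succ (x i.castSucc) (x i.succ)} with hQ
    have hle : #(Q.sigma fun x ↦ {s ∈ S | R 0 s (x 0)}) ≤
        #{x : Fin (k + 1 + 2) → V | x 0 ∈ S ∧ x (Fin.last _) ∈ T ∧
          ∀ i : Fin (k + 1 + 1), R i (x i.castSucc) (x i.succ)} := by
      refine card_le_card_of_injOn (fun x ↦ Fin.cons x.2 x.1) ?_ ?_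
      · rintro ⟨x, s⟩ hx
        simp only [coe_sigma, hQ, Set.mem_sigma_iff, coe_filter, mem_univ, true_and,
          Set.mem_ofPred_eq] at hx
        obtain ⟨⟨h1, h2, h3⟩, h4, h5⟩ := hx
        simp only [coe_filter, mem_univ, true_and, Set.mem_ofPred_eq]
        refine ⟨h4, ?_, ?_⟩
        · rw [← Fin.succ_last, Fin.cons_succ]
          exact h2
        · intro i
          induction i using Fin.cases with
          | zero => simpa using h5
          | succ i =>
            rw [← Fin.succ_castSucc, Fin.cons_succ, Fin.cons_succ]
            exact h3 i
      · rintro ⟨x, s⟩ - ⟨y, t⟩ - hxy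
        obtain ⟨rfl, rfl⟩ := Fin.cons_inj.1 hxy
        rfl
    refine le_trans ?_ (Nat.cast_le.2 hle)
    rw [card_sigma, Nat.cast_sum]
    have hsum : ∑ x ∈ Q, ρ * #S ≤ ∑ x ∈ Q, (#{s ∈ S | R 0 s (x 0)} : ℝ) := by
      refine sum_le_sum fun x hx ↦ ?_
      simp only [hQ, mem_filter, mem_univ, true_and] at hx
      exact (mem_filter.1 hx.1).2
    refine le_trans ?_ hsum
    rw [sum_const, nsmul_eq_mul, Fin.prod_univ_succ]
    have hQc : (ρ * σ) ^ k * (ρ * σ ^ 2) * ∏ i : Fin (k + 2), p i.succ ≤ #Q := key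
    calc _ = ((ρ * σ) ^ k * (ρ * σ ^ 2) * ∏ i : Fin (k + 2), p i.succ) * (ρ * (σ * p 0)) := by
          ring
      _ ≤ _ := by
          have h0 := hp 0
          gcongr

lemma Fin.forall_cyclic_iff {n : ℕ} {P : Fin (n + 3) → Fin (n + 3) → Prop} :
    (∀ i, P i (i + 1)) ↔ P 0 1 ∧ P (Fin.last _) 0 ∧
      ∀ i : Fin (n + 1), P i.castSucc.succ i.succ.succ := by
  constructor
  · intro h
    refine ⟨by simpa using h 0, by simpa using h (Fin.last _), fun i ↦ ?_⟩
    have := h i.succ.castSucc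
    rwa [Fin.coeSucc_eq_succ, ← Fin.succ_castSucc] at this
  · rintro ⟨h0, hl, h⟩ i
    induction i using Fin.lastCases with
    | last => simpa using hl
    | cast i =>
      induction i using Fin.cases with
      | zero => simpa using h0
      | succ i =>
        rw [Fin.coeSucc_eq_succ, ← Fin.succ_castSucc]
        exact h i

open scoped Classical in
/-- Counting lemma for cycles in a cyclic chain of lower regular pairs. -/
lemma cycle_counting {V : Type*} [Fintype V] {ρ σ τ : ℝ} (hρ : 0 < ρ) (hσ : 0 < σ)
    (hτ : 3 * σ ≤ τ) (hρτ : σ ≤ ρ * τ) {n : ℕ}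
    {R : Fin (n + 3) → V → V → Prop} {X : Fin (n + 3) → Finset V} {p : Fin (n + 3) → ℝ}
    (hp : ∀ i, 0 < p i) (hX : ∀ i, τ * p i ≤ #(X i))
    (hR : ∀ i, IsLowerRegular (R i) ρ σ (p i) (p (i + 1)) (X i) (X (i + 1))) :
    (ρ * σ) ^ n * (ρ * σ ^ 3) * ∏ i, p i ≤
      #{x : Fin (n + 3) → V | ∀ i, R i (x i) (x (i + 1))} := by
  obtain ⟨hR0, hRl, hRs⟩ := (Fin.forall_cyclic_iff
    (P := fun i j ↦ IsLowerRegular (R i) ρ σ (p i) (p j) (X i) (X j))).1 hR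
  have hbig (i) : σ * p i ≤ #(X i) := by
    have := hX i
    nlinarith [hp i]
  have hB1 := hR0.flip.card_lowDegree_lt hσ (hp _) subset_rfl (hbig _)
  have hB2 := hRl.card_lowDegree_lt hσ (hp _) subset_rfl (hbig _)
  set B1 := {y ∈ X 0 | (#{x ∈ X 1 | flip (R 0) x y} : ℝ) < ρ * #(X 1)} with hB1d
  set B2 := {y ∈ X 0 | (#{x ∈ X (Fin.last _) | R (Fin.last _) x y} : ℝ) <
    ρ * #(X (Fin.last _))} with hB2d
  set Y := X 0 \ (B1 ∪ B2) with hY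
  have hYc : σ * p 0 ≤ #Y := by
    have h1 : #(X 0) ≤ #Y + #(B1 ∪ B2) := by
      rw [← Nat.sub_le_iff_le_add]; exact le_card_sdiff _ _
    have h2 := h1.trans (Nat.add_le_add_left (card_union_le B1 B2) _)
    have h3 : (#(X 0) : ℝ) ≤ #Y + (#B1 + #B2) := by exact_mod_cast h2
    have := hX 0
    nlinarith [hp 0]
  set c := (ρ * σ) ^ n * (ρ * σ ^ 2) * ∏ i : Fin (n + 2), p i.succ with hc
  let F (y : V) : Finset (Fin (n + 2) → V) :=
    {x | x 0 ∈ {z ∈ X 1 | R 0 y z} ∧ x (Fin.last _) ∈ {z ∈ X (Fin.last _) | R (Fin.last _) z y} ∧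
      ∀ i : Fin (n + 1), R i.castSucc.succ (x i.castSucc) (x i.succ)}
  have hF : ∀ y ∈ Y, c ≤ #(F y) := by
    intro y hy
    simp only [hY, hB1d, hB2d, mem_sdiff, mem_union, mem_filter, not_or, not_and, not_lt] at hy
    obtain ⟨hy0, hy1, hy2⟩ := hy
    have large {i : Fin (n + 3)} {m : ℝ} (h : ρ * #(X i) ≤ m) : σ * p i ≤ m := by
      refine le_trans ?_ h
      calc σ * p i ≤ ρ * τ * p i := by have := hp i; gcongr
        _ = ρ * (τ * p i) := by ring
        _ ≤ _ := by gcongr; exact hX i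
    exact path_counting hρ hσ (by linarith) n (fun i ↦ R i.castSucc.succ) (fun i ↦ X i.succ)
      (fun i ↦ p i.succ) {z ∈ X 1 | R 0 y z} {z ∈ X (Fin.last _) | R (Fin.last _) z y}
      (fun i ↦ hp _) (fun i ↦ hX _) hRs (filter_subset _ _) (filter_subset _ _)
      (large (hy1 hy0)) (large (hy2 hy0))
  have hle : #(Y.sigma F) ≤ #{x : Fin (n + 3) → V | ∀ i, R i (x i) (x (i + 1))} := by
    refine card_le_card_of_injOn (fun x ↦ Fin.cons x.1 x.2) ?_ ?_
    · rintro ⟨y, x⟩ hx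
      simp only [F, coe_sigma, Set.mem_sigma_iff, coe_filter, mem_filter, mem_univ, true_and,
        Set.mem_ofPred_eq] at hx
      obtain ⟨-, ⟨-, h1⟩, ⟨-, h2⟩, h3⟩ := hx
      simp only [coe_filter, mem_univ, true_and, Set.mem_ofPred_eq]
      refine (Fin.forall_cyclic_iff (P := fun i j ↦ R i ((Fin.cons y x : Fin (n + 3) → V) i)
        ((Fin.cons y x : Fin (n + 3) → V) j))).2 ⟨h1, ?_, ?_⟩
      · rw [← Fin.succ_last, Fin.cons_succ]
        exact h2
      · intro i
        rw [Fin.cons_succ, Fin.cons_succ]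
        exact h3 i
    · rintro ⟨x, s⟩ - ⟨y, t⟩ - hxy
      obtain ⟨rfl, rfl⟩ := Fin.cons_inj.1 hxy
      rfl
  refine le_trans ?_ (Nat.cast_le.2 hle)
  rw [card_sigma, Nat.cast_sum]
  refine le_trans ?_ (card_nsmul_le_sum Y _ c hF)
  rw [nsmul_eq_mul, Fin.prod_univ_succ]
  have hc0 : 0 ≤ c := by
    have := prod_nonneg fun (i : Fin (n + 2)) (_ : i ∈ univ) ↦ (hp i.succ).le
    positivity
  calc _ = σ * p 0 * c := by rw [hc]; ring
    _ ≤ _ := by gcongr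

/-- The graph on `n + 3` copies of `V` whose edges between consecutive copies, in cyclic order, are
given by the relations `R i`. -/
def layeredGraph {V : Type*} {n : ℕ} (R : Fin (n + 3) → V → V → Prop) :
    SimpleGraph (Fin (n + 3) × V) :=
  SimpleGraph.fromRel fun u v ↦ v.1 = u.1 + 1 ∧ R u.1 u.2 v.2

/-- The elements of `V` whose copy in layer `i` lies in `U`. -/
def layerSlice {ι V : Type*} [Fintype V] [DecidableEq ι] [DecidableEq V] (i : ι)
    (U : Finset (ι × V)) : Finset V :=
  {y | (i, y) ∈ U}

section Layered

variable {V : Type*} {n : ℕ} {R : Fin (n + 3) → V → V → Prop}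

lemma layeredGraph_adj {i : Fin (n + 3)} {x y : V} :
    (layeredGraph R).Adj (i, x) (i + 1, y) ↔ R i x y := by
  have h1 : i ≠ i + 1 := by simp
  have h2 : i ≠ i + 1 + 1 := by
    rw [add_assoc, ne_eq, left_eq_add, Fin.ext_iff]
    simp [Fin.val_add, Nat.mod_eq_of_lt (show 2 < n + 3 by omega)]
  simp [layeredGraph, h1, h2]

open scoped Classical in
lemma edgeDensity_layeredGraph (i : Fin (n + 3)) (S T : Finset V) :
    ((layeredGraph R).edgeDensity (S.map (.sectR i V)) (T.map (.sectR (i + 1) V)) : ℝ) =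
      #(Rel.interedges (R i) S T) / (#S * #T) := by
  have e : #((layeredGraph R).interedges (S.map (.sectR i V)) (T.map (.sectR (i + 1) V))) =
      #(Rel.interedges (R i) S T) := by
    symm
    refine card_bij (fun x _ ↦ ((i, x.1), (i + 1, x.2))) ?_ ?_ ?_
    · rintro ⟨x, y⟩ h
      simpa [Rel.mem_interedges_iff, SimpleGraph.mem_interedges_iff, layeredGraph_adj] using h
    · rintro ⟨x, y⟩ - ⟨z, w⟩ - h
      simpa using h
    · rintro ⟨u, v⟩ h
      simp only [SimpleGraph.mem_interedges_iff, mem_map, Function.Embedding.sectR_apply] at h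
      obtain ⟨⟨x, hx, rfl⟩, ⟨y, hy, rfl⟩, h⟩ := h
      exact ⟨(x, y), by simpa [Rel.mem_interedges_iff, hx, hy] using layeredGraph_adj.1 h, rfl⟩
  rw [SimpleGraph.edgeDensity_def, e]
  simp

variable [Fintype V] [DecidableEq V]

lemma map_layerSlice_subset {ι : Type*} [DecidableEq ι] (i : ι) (U : Finset (ι × V)) :
    (layerSlice i U).map (.sectR i V) ⊆ U := by
  intro u
  simp only [layerSlice, mem_map, mem_filter, mem_univ, true_and]
  rintro ⟨x, hx, rfl⟩
  exact hx

lemma card_layerSlice_le {ι : Type*} [DecidableEq ι] (i : ι) (U : Finset (ι × V)) :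
    #(layerSlice i U) ≤ #U := by
  simpa using card_le_card (map_layerSlice_subset i U)

open scoped Classical in
lemma le_card_layerSlice_of_dense {d : ℝ} {i : Fin (n + 3)}
    {U W : Finset (Fin (n + 3) × V)} (hU : U.Nonempty) (hW : W.Nonempty)
    (hd : d * #U * #W ≤ #(Rel.interedges (R i) (layerSlice i U) (layerSlice (i + 1) W))) :
    d * #U ≤ #(layerSlice i U) ∧ d * #W ≤ #(layerSlice (i + 1) W) := by
  have hU' : (0 : ℝ) < #U := by exact_mod_cast hU.card_pos
  have hW' : (0 : ℝ) < #W := by exact_mod_cast hW.card_pos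
  have h1 : (#(Rel.interedges (R i) (layerSlice i U) (layerSlice (i + 1) W)) : ℝ) ≤
      #(layerSlice i U) * #(layerSlice (i + 1) W) := by
    exact_mod_cast Rel.card_interedges_le_mul (R i) _ _
  have h2 : (#(layerSlice i U) : ℝ) ≤ #U := by exact_mod_cast card_layerSlice_le i U
  have h3 : (#(layerSlice (i + 1) W) : ℝ) ≤ #W := by
    exact_mod_cast card_layerSlice_le (i + 1) W
  constructor
  · refine le_of_mul_le_mul_right ((hd.trans h1).trans ?_) hW'
    gcongr
  · refine le_of_mul_le_mul_right ?_ hU'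
    calc d * #W * #U = d * #U * #W := by ring
      _ ≤ _ := hd.trans h1
      _ ≤ #U * #(layerSlice (i + 1) W) := by gcongr
      _ = _ := by ring

open scoped Classical in
lemma isLowerRegular_of_isUniform {d : ℝ} (hd0 : 0 < d) (hd1 : d ≤ 1) {i : Fin (n + 3)}
    {U W : Finset (Fin (n + 3) × V)} (hU : U.Nonempty) (hW : W.Nonempty)
    (h : (layeredGraph R).IsUniform (d ^ 2 / 3) U W)
    (hd : d * #U * #W ≤ #(Rel.interedges (R i) (layerSlice i U) (layerSlice (i + 1) W))) :
    IsLowerRegular (R i) (d / 3) (d ^ 2 / 3) #U #W (layerSlice i U) (layerSlice (i + 1) W) := by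
  obtain ⟨hX, hY⟩ := le_card_layerSlice_of_dense hU hW hd
  have hU' : (0 : ℝ) < #U := by exact_mod_cast hU.card_pos
  have hW' : (0 : ℝ) < #W := by exact_mod_cast hW.card_pos
  have hdd : d ^ 2 / 3 ≤ d := by nlinarith
  have key {S T : Finset V} (hS : S ⊆ layerSlice i U) (hT : T ⊆ layerSlice (i + 1) W)
      (hS' : d ^ 2 / 3 * #U ≤ #S) (hT' : d ^ 2 / 3 * #W ≤ #T) :=
    h ((map_subset_map.2 hS).trans (map_layerSlice_subset i U))
      ((map_subset_map.2 hT).trans (map_layerSlice_subset (i + 1) W))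
      (by rw [card_map]; linarith) (by rw [card_map]; linarith)
  have hXY := key subset_rfl subset_rfl ((by gcongr : _ ≤ d * (#U : ℝ)).trans hX)
    ((by gcongr : _ ≤ d * (#W : ℝ)).trans hY)
  rw [edgeDensity_layeredGraph, abs_lt] at hXY
  have hdens : d ≤ #(Rel.interedges (R i) (layerSlice i U) (layerSlice (i + 1) W)) /
      (#(layerSlice i U) * #(layerSlice (i + 1) W)) := by
    have hX0 : (0 : ℝ) < #(layerSlice i U) := (by positivity : 0 < d * (#U : ℝ)).trans_le hX
    have hY0 : (0 : ℝ) < #(layerSlice (i + 1) W) :=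
      (by positivity : 0 < d * (#W : ℝ)).trans_le hY
    rw [le_div_iff₀ (by positivity)]
    refine le_trans ?_ hd
    rw [mul_assoc]
    gcongr
    · exact card_layerSlice_le i U
    · exact card_layerSlice_le (i + 1) W
  intro S hS T hT hS' hT'
  have hST := key hS hT hS' hT'
  rw [edgeDensity_layeredGraph, abs_lt] at hST
  have hS0 : (0 : ℝ) < #S := (by positivity : 0 < d ^ 2 / 3 * (#U : ℝ)).trans_le hS'
  have hT0 : (0 : ℝ) < #T := (by positivity : 0 < d ^ 2 / 3 * (#W : ℝ)).trans_le hT'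
  have : d / 3 ≤ #(Rel.interedges (R i) S T) / (#S * #T) := by nlinarith [hST.1, hXY.2]
  rw [le_div_iff₀ (by positivity)] at this
  linarith

open scoped Classical in
/-- The pairs between layers `i` and `i + 1` lying inside a part, between parts that do not form an
`η`-uniform pair, or forming an edge between parts `U` and `W` whose slices span fewer than
`d * #U * #W` edges. -/
noncomputable def badEdges (R : Fin (n + 3) → V → V → Prop)
    (P : Finpartition (univ : Finset (Fin (n + 3) × V))) (η d : ℝ) (i : Fin (n + 3)) :
    Finset (V × V) :=
  {e | P.part (i, e.1) = P.part (i + 1, e.2) ∨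
    ¬ (layeredGraph R).IsUniform η (P.part (i, e.1)) (P.part (i + 1, e.2)) ∨
    (R i e.1 e.2 ∧ (#(Rel.interedges (R i) (layerSlice i (P.part (i, e.1)))
      (layerSlice (i + 1) (P.part (i + 1, e.2)))) : ℝ) <
        d * #(P.part (i, e.1)) * #(P.part (i + 1, e.2)))}

open scoped Classical in
lemma card_badEdges_le [Nonempty V] {P : Finpartition (univ : Finset (Fin (n + 3) × V))}
    {η d κ : ℝ} (hη : 0 < η) (hd : 0 ≤ d) (hκ : 0 < κ) (hP : P.IsEquipartition)
    (hPη : P.IsUniform (layeredGraph R) η) (hPκ : 4 / κ ≤ #P.parts) (i : Fin (n + 3)) :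
    (#(badEdges R P η d i) : ℝ) ≤
      (4 * η + κ / 2 + d) * (Fintype.card (Fin (n + 3) × V) : ℝ) ^ 2 := by
  let A := (P.nonUniforms (layeredGraph R) η).biUnion fun (U, W) ↦ U ×ˢ W
  let B := P.parts.biUnion offDiag
  let E (q : Finset (Fin (n + 3) × V) × Finset (Fin (n + 3) × V)) : Finset (V × V) :=
    Rel.interedges (R i) (layerSlice i q.1) (layerSlice (i + 1) q.2)
  let Q := {q ∈ P.parts ×ˢ P.parts | (#(E q) : ℝ) < d * #q.1 * #q.2}
  let ψ (e : V × V) : (Fin (n + 3) × V) × (Fin (n + 3) × V) := ((i, e.1), (i + 1, e.2))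
  let C := Q.biUnion fun q ↦ (E q).image ψ
  have hψ : Function.Injective ψ := by
    rintro ⟨a, b⟩ ⟨c, e⟩ h
    simpa [ψ] using h
  have hsub : (badEdges R P η d i).image ψ ⊆ A ∪ B ∪ C := by
    intro u hu
    obtain ⟨⟨x, y⟩, hxy, rfl⟩ := mem_image.1 hu
    simp only [badEdges, mem_filter, mem_univ, true_and] at hxy
    have hx := P.part_mem.2 (mem_univ (i, x))
    have hy := P.part_mem.2 (mem_univ (i + 1, y))
    have hx' := P.mem_part (mem_univ (i, x))
    have hy' := P.mem_part (mem_univ (i + 1, y))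
    rw [mem_union, mem_union]
    by_cases heq : P.part (i, x) = P.part (i + 1, y)
    · refine Or.inl (Or.inr (mem_biUnion.2 ⟨_, hx, mem_offDiag.2 ⟨hx', ?_, ?_⟩⟩))
      · rw [heq]; exact hy'
      · simp [ψ]
    · obtain h | h | ⟨h, h'⟩ := hxy
      · exact absurd h heq
      · exact Or.inl (Or.inl (mem_biUnion.2 ⟨(_, _), (P.mk_mem_nonUniforms _).2 ⟨hx, hy, heq, h⟩,
          mem_product.2 ⟨hx', hy'⟩⟩))
      · refine Or.inr (mem_biUnion.2 ⟨(_, _), mem_filter.2 ⟨mem_product.2 ⟨hx, hy⟩, h'⟩,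
          mem_image_of_mem _ ?_⟩)
        simpa [E, Rel.mem_interedges_iff, layerSlice] using ⟨hx', hy', h⟩
  have hA : (#A : ℝ) < 4 * η * (Fintype.card (Fin (n + 3) × V) : ℝ) ^ 2 := by
    simpa using hP.sum_nonUniforms_lt univ_nonempty hη hPη
  have hB : (#B : ℝ) ≤ κ / 2 * (Fintype.card (Fin (n + 3) × V) : ℝ) ^ 2 := by
    simpa using hP.card_biUnion_offDiag_le hκ hPκ
  have hC : (#C : ℝ) ≤ d * (Fintype.card (Fin (n + 3) × V) : ℝ) ^ 2 := by
    calc (#C : ℝ) ≤ ∑ q ∈ Q, (#((E q).image ψ) : ℝ) := by exact_mod_cast card_biUnion_le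
      _ ≤ ∑ q ∈ Q, d * #q.1 * #q.2 := by
        refine sum_le_sum fun q hq ↦ ?_
        rw [card_image_of_injective _ hψ]
        exact (mem_filter.1 hq).2.le
      _ ≤ ∑ q ∈ P.parts ×ˢ P.parts, d * #q.1 * #q.2 :=
        sum_le_sum_of_subset_of_nonneg (filter_subset _ _) fun _ _ _ ↦ by positivity
      _ = d * (∑ U ∈ P.parts, (#U : ℝ)) * ∑ W ∈ P.parts, (#W : ℝ) := by
        simp only [sum_product, mul_sum, sum_mul]
        rw [sum_comm]
      _ = _ := by
        rw [← Nat.cast_sum, P.sum_card_parts, card_univ]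
        ring
  have hle : (#(badEdges R P η d i) : ℝ) ≤ #A + #B + #C := by
    rw [← card_image_of_injective _ hψ]
    have h1 := card_le_card hsub
    have h2 := card_union_le (A ∪ B) C
    have h3 := card_union_le A B
    exact_mod_cast h1.trans (h2.trans (by gcongr))
  linarith

end Layered

open scoped Classical in
/-- **Removal lemma for cycles** in layered graphs. -/
theorem cycle_removal (n : ℕ) {ε : ℝ} (hε : 0 < ε) : ∃ δ : ℝ, 0 < δ ∧
    ∀ (V : Type) [Fintype V] [Nonempty V] (R : Fin (n + 3) → V → V → Prop),
      (#{x : Fin (n + 3) → V | ∀ i, R i (x i) (x (i + 1))} : ℝ) ≤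
        δ * (Fintype.card V : ℝ) ^ (n + 3) →
      ∃ D : Fin (n + 3) → Finset (V × V), (∀ i, (#(D i) : ℝ) ≤ ε * (Fintype.card V : ℝ) ^ 2) ∧
        ∀ x : Fin (n + 3) → V, (∀ i, R i (x i) (x (i + 1))) → ∃ i, (x i, x (i + 1)) ∈ D i := by
  set κ : ℝ := min 1 (ε / (n + 3) ^ 2) with hκ
  have hκ0 : 0 < κ := by positivity
  have hκ1 : κ ≤ 1 := min_le_left _ _
  have hκε : κ * (n + 3) ^ 2 ≤ ε := by
    rw [← le_div_iff₀ (by positivity)]; exact min_le_right _ _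
  set d : ℝ := κ / 4 with hd
  have hd0 : 0 < d := by positivity
  have hd1 : d ≤ 1 := by linarith
  set η : ℝ := d ^ 2 / 3 with hη
  have hη0 : 0 < η := by positivity
  set l : ℕ := ⌈4 / κ⌉₊ with hl
  have hl0 : 0 < l := by positivity
  set M : ℕ := SzemerediRegularity.bound η l with hM
  have hM0 : 0 < M := SzemerediRegularity.bound_pos _ _
  set c : ℝ := (d / 3 * η) ^ n * (d / 3 * η ^ 3) * (1 / (2 * M)) ^ (n + 3) with hc
  have hc0 : 0 < c := by positivity
  refine ⟨min (1 / (2 * l ^ (n + 3))) (c / 2), by positivity, ?_⟩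
  intro V _ _ R hcount
  have hV0 : 0 < Fintype.card V := Fintype.card_pos
  have hcard : Fintype.card (Fin (n + 3) × V) = (n + 3) * Fintype.card V := by simp
  obtain hlt | hle := lt_or_ge (Fintype.card (Fin (n + 3) × V)) l
  · refine ⟨fun _ ↦ ∅, fun i ↦ by simp; positivity, fun x hx ↦ ?_⟩
    exfalso
    have h1 : 0 < #{x : Fin (n + 3) → V | ∀ i, R i (x i) (x (i + 1))} :=
      card_pos.2 ⟨x, by simpa using hx⟩
    have h1' : (1 : ℝ) ≤ #{x : Fin (n + 3) → V | ∀ i, R i (x i) (x (i + 1))} := by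
      exact_mod_cast h1
    have h2 : (Fintype.card V : ℝ) ≤ l := by
      have : Fintype.card V ≤ l := by nlinarith
      exact_mod_cast this
    have h3 : (1 : ℝ) ≤ 1 / (2 * l ^ (n + 3)) * l ^ (n + 3) := by
      refine (h1'.trans hcount).trans ?_
      gcongr
      exact min_le_left _ _
    have h4 : (1 : ℝ) / (2 * l ^ (n + 3)) * l ^ (n + 3) = 1 / 2 := by field_simp
    linarith
  · obtain ⟨P, hP, hPl, hPM, hPu⟩ := szemeredi_regularity (layeredGraph R) hη0 hle
    have hPκ : 4 / κ ≤ #P.parts := (Nat.le_ceil _).trans (by exact_mod_cast hPl)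
    refine ⟨badEdges R P η d, fun i ↦ ?_, fun x hx ↦ ?_⟩
    · refine (card_badEdges_le hη0 hd0.le hκ0 hP hPu hPκ i).trans ?_
      rw [hcard]
      push_cast
      calc _ ≤ κ * ((n + 3) * (Fintype.card V : ℝ)) ^ 2 := by
            gcongr
            nlinarith
        _ = κ * (n + 3) ^ 2 * (Fintype.card V : ℝ) ^ 2 := by ring
        _ ≤ _ := by gcongr
    · by_contra! hbad
      simp only [badEdges, mem_filter, mem_univ, true_and, not_or, not_not, not_and, not_lt]
        at hbad
      set U : Fin (n + 3) → Finset (Fin (n + 3) × V) := fun i ↦ P.part (i, x i) with hU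
      have hUmem (i) : U i ∈ P.parts := P.part_mem.2 (mem_univ _)
      have hUne (i) : (U i).Nonempty := P.nonempty_of_mem_parts (hUmem i)
      have hUcard (i) : 1 / (2 * M) * (Fintype.card V : ℝ) ≤ #(U i) := by
        have h1 := hP.average_le_card_part (hUmem i)
        have hpos : 0 < #P.parts := card_pos.2 ⟨_, hUmem i⟩
        have h2 : #P.parts ≤ Fintype.card (Fin (n + 3) × V) := P.card_parts_le_card
        rw [card_univ] at h1
        set b := Fintype.card (Fin (n + 3) × V) / #P.parts with hb
        have hb1 : 1 ≤ b := (Nat.one_le_div_iff hpos).2 h2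
        have h3 : Fintype.card V ≤ 2 * M * #(U i) := by
          calc Fintype.card V ≤ Fintype.card (Fin (n + 3) × V) := by rw [hcard]; nlinarith
            _ ≤ #P.parts * (b + 1) := (Nat.lt_mul_div_succ _ hpos).le
            _ ≤ M * (2 * #(U i)) := by gcongr; linarith
            _ = _ := by ring
        have h4 : (Fintype.card V : ℝ) ≤ 2 * M * #(U i) := by exact_mod_cast h3
        rw [one_div, inv_mul_le_iff₀ (by positivity)]
        exact h4
      have hdense (i) := (hbad i).2.2 (hx i)
      have hcyc := cycle_counting (R := R) (ρ := d / 3) (σ := η) (τ := d)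
        (X := fun i ↦ layerSlice i (U i)) (p := fun i ↦ (#(U i) : ℝ))
        (by positivity) hη0 (by nlinarith) (by rw [hη]; linarith [sq d])
        (fun i ↦ by exact_mod_cast (hUne i).card_pos)
        (fun i ↦ (le_card_layerSlice_of_dense (hUne i) (hUne (i + 1)) (hdense i)).1)
        (fun i ↦ isLowerRegular_of_isUniform hd0 hd1 (hUne i) (hUne (i + 1)) (hbad i).2.1
          (hdense i))
      have hprod : (1 / (2 * M) * (Fintype.card V : ℝ)) ^ (n + 3) ≤ ∏ i, (#(U i) : ℝ) := by
        calc _ = ∏ _i : Fin (n + 3), (1 / (2 * M) * (Fintype.card V : ℝ)) := by simp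
          _ ≤ _ := prod_le_prod (fun _ _ ↦ by positivity) fun i _ ↦ hUcard i
      have hlow : c * (Fintype.card V : ℝ) ^ (n + 3) ≤
          #{x : Fin (n + 3) → V | ∀ i, R i (x i) (x (i + 1))} := by
        refine le_trans ?_ hcyc
        rw [hc, mul_assoc, ← mul_pow]
        gcongr
      have hup : (#{x : Fin (n + 3) → V | ∀ i, R i (x i) (x (i + 1))} : ℝ) ≤
          c / 2 * (Fintype.card V : ℝ) ^ (n + 3) := by
        refine hcount.trans ?_
        gcongr
        exact min_le_right _ _
      have : 0 < c * (Fintype.card V : ℝ) ^ (n + 3) := by positivity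
      linarith

open scoped Classical in
/-- Each cycle `x` with steps in the sets `A i` is determined by `x 0` and its steps, which sum to
zero. -/
lemma card_cycles_le_card_mul_card_solutions {G : Type*} [AddCommGroup G] [Fintype G] {n : ℕ}
    (A : Fin (n + 3) → Finset G) :
    #{x : Fin (n + 3) → G | ∀ i, x (i + 1) - x i ∈ A i} ≤
      Fintype.card G * #{a ∈ Fintype.piFinset A | ∑ i, a i = 0} := by
  rw [← card_univ, ← card_product]
  refine card_le_card_of_injOn (fun x ↦ (x 0, fun i ↦ x (i + 1) - x i)) ?_ ?_
  · intro x hx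
    simp only [coe_filter, mem_univ, true_and, Set.mem_ofPred_eq] at hx
    simp only [coe_product, coe_univ, Set.mem_prod, Set.mem_univ, true_and, mem_coe, mem_filter,
      Fintype.mem_piFinset]
    refine ⟨hx, ?_⟩
    rw [sum_sub_distrib, sub_eq_zero]
    exact Equiv.sum_comp (Equiv.addRight (1 : Fin (n + 3))) x
  · rintro x - y - hxy
    simp only [Prod.mk.injEq] at hxy
    funext i
    induction i using Fin.induction with
    | zero => exact hxy.1
    | succ i ih =>
      have := congrFun hxy.2 i.castSucc
      rw [Fin.coeSucc_eq_succ, ih] at this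
      exact sub_left_injective this

/-- The partial sums of a solution `a` form a cycle with steps `a i`. -/
lemma sum_Iio_add_one_of_sum_eq_zero {G : Type*} [AddCommGroup G] {n : ℕ} {a : Fin (n + 3) → G}
    (ha : ∑ i, a i = 0) (i : Fin (n + 3)) :
    ∑ j ∈ Finset.Iio (i + 1), a j = ∑ j ∈ Finset.Iio i, a j + a i := by
  rw [sum_Iio_add_eq_sum_Iic]
  induction i using Fin.lastCases with
  | last =>
    have h : Finset.Iic (Fin.last (n + 2)) = univ := by ext j; simp [Fin.le_last]
    rw [h, ha, Fin.last_add_one]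
    exact sum_eq_zero fun j hj ↦ by simp at hj
  | cast i =>
    congr 1
    ext j
    rw [Fin.coeSucc_eq_succ, mem_Iio, mem_Iic, Fin.lt_def, Fin.le_def]
    simp

/-- **Removal Lemma for abelian groups** (Green).
For every `ε > 0` and every integer `m ≥ 3` there is a `δ > 0` (depending only on
`ε` and `m`) such that for every finite abelian group `G` of order `N` and subsets
`A₁, …, A_m` of `G`: if the number of tuples `(a₁, …, a_m) ∈ A₁ × ⋯ × A_m` with
`a₁ + ⋯ + a_m = 0` is at most `δ·N^(m-1)`, then one can pass to subsets
`A′ᵢ ⊆ Aᵢ` with `|Aᵢ \ A′ᵢ| ≤ ε·N` admitting no such solution at all. -/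
theorem removal_lemma_abelian_groups :
    ∀ ε : ℝ, 0 < ε → ∀ m : ℕ, 3 ≤ m → ∃ δ : ℝ, 0 < δ ∧
      ∀ (G : Type) [AddCommGroup G] [Fintype G] [DecidableEq G]
        (A : Fin m → Finset G),
        ((((Fintype.piFinset A).filter (fun a : Fin m → G => ∑ i, a i = 0)).card : ℝ)
            ≤ δ * (Fintype.card G : ℝ) ^ (m - 1)) →
        ∃ A' : Fin m → Finset G,
          (∀ i, A' i ⊆ A i) ∧
          (∀ i, (((A i) \ (A' i)).card : ℝ) ≤ ε * (Fintype.card G : ℝ)) ∧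
          ¬ ∃ a : Fin m → G, (∀ i, a i ∈ A' i) ∧ ∑ i, a i = 0 := by
  intro ε hε m hm
  obtain ⟨n, rfl⟩ := Nat.exists_eq_add_of_le' hm
  obtain ⟨δ, hδ, h⟩ := cycle_removal n (by positivity : 0 < ε / (n + 3))
  refine ⟨δ, hδ, fun G _ _ _ A hA ↦ ?_⟩
  have hG : (0 : ℝ) < Fintype.card G := by exact_mod_cast Fintype.card_pos
  obtain ⟨D, hD, hDx⟩ := h G (fun i x y ↦ y - x ∈ A i) (by
    have h1 := card_cycles_le_card_mul_card_solutions A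
    have h2 : (#{x : Fin (n + 3) → G | ∀ i, x (i + 1) - x i ∈ A i} : ℝ) ≤
        Fintype.card G * #{a ∈ Fintype.piFinset A | ∑ i, a i = 0} := by
      rw [← Nat.cast_mul, Nat.cast_le]
      convert h1
    rw [show n + 3 - 1 = n + 2 from rfl] at hA
    calc _ = (#{x : Fin (n + 3) → G | ∀ i, x (i + 1) - x i ∈ A i} : ℝ) := by congr
      _ ≤ _ := h2
      _ ≤ Fintype.card G * (δ * (Fintype.card G : ℝ) ^ (n + 2)) := by gcongr
      _ = _ := by ring)
  let E (i : Fin (n + 3)) (a : G) : Finset G := {x | (x, x + a) ∈ D i}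
  refine ⟨fun i ↦ {a ∈ A i | (n + 3) * #(E i a) < Fintype.card G}, fun i ↦ filter_subset _ _,
    fun i ↦ ?_, ?_⟩
  · set B := A i \ {a ∈ A i | (n + 3) * #(E i a) < Fintype.card G} with hB
    have hBD : #(B.sigma (E i)) ≤ #(D i) := by
      refine card_le_card_of_injOn (fun q ↦ (q.2, q.2 + q.1)) ?_ ?_
      · rintro ⟨a, x⟩ hq
        simp only [mem_coe, mem_sigma, E, mem_filter, mem_univ, true_and] at hq
        exact hq.2
      · rintro ⟨a, x⟩ - ⟨b, y⟩ - hq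
        obtain ⟨rfl, hab⟩ := Prod.mk.inj hq
        obtain rfl := add_left_cancel hab
        rfl
    have hle : #B * Fintype.card G ≤ (n + 3) * #(D i) := by
      calc #B * Fintype.card G ≤ ∑ a ∈ B, (n + 3) * #(E i a) := by
            rw [← smul_eq_mul]
            refine card_nsmul_le_sum _ _ _ fun a ha ↦ ?_
            simp only [hB, mem_sdiff, mem_filter, not_and, not_lt] at ha
            exact ha.2 ha.1
        _ = (n + 3) * #(B.sigma (E i)) := by rw [card_sigma, mul_sum]
        _ ≤ _ := by gcongr
    have hle' : (#B : ℝ) * Fintype.card G ≤ (n + 3) * #(D i) := by exact_mod_cast hle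
    refine le_of_mul_le_mul_right ?_ hG
    calc _ ≤ _ := hle'
      _ ≤ (n + 3) * (ε / (n + 3) * (Fintype.card G : ℝ) ^ 2) := by gcongr; exact hD i
      _ = _ := by field_simp
  · rintro ⟨a, ha, hsum⟩
    let s (i : Fin (n + 3)) : G := ∑ j ∈ Finset.Iio i, a j
    let F (i : Fin (n + 3)) : Finset G := {x | x + s i ∈ E i (a i)}
    have hF (i) : #(F i) = #(E i (a i)) :=
      card_equiv (Equiv.addRight (s i)) fun x ↦ by simp [F]
    have hcov : univ ⊆ univ.biUnion F := by
      intro x _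
      obtain ⟨i, hi⟩ := hDx (fun i ↦ x + s i) fun i ↦ by
        have := (mem_filter.1 (ha i)).1
        simpa [s, sum_Iio_add_one_of_sum_eq_zero hsum] using this
      refine mem_biUnion.2 ⟨i, mem_univ _, ?_⟩
      simpa [F, E, s, sum_Iio_add_one_of_sum_eq_zero hsum, add_assoc] using hi
    have h1 : Fintype.card G ≤ ∑ i, #(E i (a i)) := by
      rw [← card_univ]
      simpa only [hF] using (card_le_card hcov).trans card_biUnion_le
    have h2 : ∑ i : Fin (n + 3), (n + 3) * #(E i (a i)) < ∑ _i : Fin (n + 3), Fintype.card G :=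
      sum_lt_sum_of_nonempty univ_nonempty fun i _ ↦ (mem_filter.1 (ha i)).2
    rw [← mul_sum, sum_const, card_univ, Fintype.card_fin, smul_eq_mul] at h2
    exact absurd (Nat.lt_of_mul_lt_mul_left h2) (not_lt.2 h1)
end

section
/- For every ε > 0 and every integer m ≥ 2 there exists δ > 0 (depending only on ε and m) such that the following holds. Let G be a finite group of order N (written multiplicatively, not necessarily abelian), let g ∈ G, and let A₁, …, A_m be subsets of G. If the number of m-tuples (x₁, …, x_m) with xᵢ ∈ Aᵢ for all i and x₁x₂⋯x_m = g is at most δ·N^{m-1}, then there exist subsets A′ᵢ ⊆ Aᵢ with |Aᵢ \ A′ᵢ| ≤ ε·N for every i, such that there is no m-tuple (x′₁, …, x′_m) with x′ᵢ ∈ A′ᵢ for all i and x′₁x′₂⋯x′_m = g. -/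
open Finset

section CycleCounting

variable {G : Type*} [Group G] [DecidableEq G]

/-- The number of `(a₀, …, a_{k-1}) ∈ B 0 × ⋯ × B (k-1)` with `a₀ ⋯ a_{k-1} = y`. -/
def prodCount (B : ℕ → Finset G) : ℕ → G → ℕ
  | 0, y => if y = 1 then 1 else 0
  | k + 1, y => ∑ a ∈ B k, prodCount B k (y * a⁻¹)

lemma prodCount_congr {B B' : ℕ → Finset G} {k : ℕ} (h : ∀ i < k, B i = B' i) (y : G) :
    prodCount B k y = prodCount B' k y := by
  induction k generalizing y with
  | zero => rfl
  | succ k ih =>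
    simp only [prodCount, h k k.lt_succ_self]
    exact sum_congr rfl fun a _ ↦ ih (fun i hi ↦ h i (hi.trans k.lt_succ_self)) _

lemma card_filter_prod_eq_prodCount (B : ℕ → Finset G) (k : ℕ) (y : G) :
    #{x ∈ Fintype.piFinset fun i : Fin k ↦ B i | (List.ofFn x).prod = y} = prodCount B k y := by
  induction k generalizing y with
  | zero => simp [prodCount, eq_comm, apply_ite card]
  | succ k ih =>
    simp only [prodCount, ← ih]
    rw [← card_sigma]
    refine card_bij' (fun x _ ↦ ⟨x (Fin.last k), fun i ↦ x i.castSucc⟩)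
      (fun p _ ↦ Fin.snoc p.2 p.1) ?_ ?_ ?_ ?_
    · intro x hx
      simp only [mem_filter, Fintype.mem_piFinset, mem_sigma] at hx ⊢
      refine ⟨hx.1 (Fin.last k), fun i ↦ hx.1 i.castSucc, ?_⟩
      rw [← hx.2, List.ofFn_succ', List.prod_concat]
      simp
    · rintro ⟨a, x⟩ hx
      simp only [mem_filter, Fintype.mem_piFinset, mem_sigma] at hx ⊢
      refine ⟨fun i ↦ ?_, ?_⟩
      · induction i using Fin.lastCases with
        | last => simpa using hx.1
        | cast i => simpa using hx.2.1 i
      · rw [List.ofFn_succ', List.prod_concat]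
        simp [hx.2.2]
    · intro x _
      exact Fin.snoc_init_self x
    · rintro ⟨a, x⟩ _
      simp

lemma sum_prodCount_le_prodCount_succ (B : ℕ → Finset G) (k : ℕ) (u y : G) (X : Finset G) :
    ∑ x ∈ X with x⁻¹ * y ∈ B k, prodCount B k (u⁻¹ * x) ≤ prodCount B (k + 1) (u⁻¹ * y) := by
  calc ∑ x ∈ X with x⁻¹ * y ∈ B k, prodCount B k (u⁻¹ * x)
      = ∑ a ∈ {x ∈ X | x⁻¹ * y ∈ B k}.image (·⁻¹ * y), prodCount B k (u⁻¹ * y * a⁻¹) := by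
        rw [sum_image fun x _ z _ h ↦ by simpa using h]
        simp [mul_assoc]
    _ ≤ prodCount B (k + 1) (u⁻¹ * y) := by
        refine sum_le_sum_of_subset fun a ha ↦ ?_
        obtain ⟨x, hx, rfl⟩ := mem_image.1 ha
        exact (mem_filter.1 hx).2

/-- In the bipartite graph between `S` and `T` given by `R`, any two sets of size at least `t`
have edge density at least `c`. -/
def DenseBetween {α β : Type*} (R : α → β → Prop) [∀ a b, Decidable (R a b)] (c t : ℝ)
    (S : Finset α) (T : Finset β) : Prop :=
  ∀ X ⊆ S, ∀ Y ⊆ T, t ≤ #X → t ≤ #Y → c * #X * #Y ≤ ∑ x ∈ X, (#{y ∈ Y | R x y} : ℝ)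

lemma DenseBetween.swap {α β : Type*} {R : α → β → Prop} [∀ a b, Decidable (R a b)] {c t : ℝ}
    {S : Finset α} {T : Finset β} (h : DenseBetween R c t S T) :
    DenseBetween (Function.swap R) c t T S := by
  intro Y hY X hX htY htX
  have := h X hX Y hY htX htY
  have e := sum_card_bipartiteAbove_eq_sum_card_bipartiteBelow (s := X) (t := Y) R
  simp only [bipartiteAbove, bipartiteBelow] at e
  have e' : ∑ x ∈ X, (#{y ∈ Y | R x y} : ℝ) = ∑ y ∈ Y, (#{x ∈ X | R x y} : ℝ) := mod_cast e
  simp only [Function.swap]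
  linarith

lemma DenseBetween.card_low_degree_lt {α β : Type*} {R : α → β → Prop}
    [∀ a b, Decidable (R a b)] {c t : ℝ} {S : Finset α} {T Y : Finset β}
    (h : DenseBetween R c t S T) (ht : 0 < t) (hY : Y ⊆ T) (htY : t ≤ #Y) :
    (#{x ∈ S | (#{y ∈ Y | R x y} : ℝ) < c * #Y} : ℝ) < t := by
  by_contra! hX
  have h1 := h _ (filter_subset _ _) Y hY hX htY
  have hne : ({x ∈ S | (#{y ∈ Y | R x y} : ℝ) < c * #Y} : Finset α).Nonempty :=
    card_pos.1 (Nat.cast_pos.1 (ht.trans_le hX))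
  have h2 := sum_lt_sum_of_nonempty hne fun x hx ↦ (mem_filter.1 hx).2
  rw [sum_const, nsmul_eq_mul] at h2
  linarith

lemma DenseBetween.le_card_high_degree {α β : Type*} {R : α → β → Prop}
    [∀ a b, Decidable (R a b)] {c t : ℝ} {S : Finset α} {T Y : Finset β}
    (h : DenseBetween R c t S T) (ht : 0 < t) (hY : Y ⊆ T) (htY : t ≤ #Y) :
    (#S - t : ℝ) ≤ #{x ∈ S | c * #Y ≤ (#{y ∈ Y | R x y} : ℝ)} := by
  have h1 := h.card_low_degree_lt ht hY htY
  have h2 := card_filter_add_card_filter_not (s := S) fun x ↦ (#{y ∈ Y | R x y} : ℝ) < c * #Y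
  simp only [not_lt] at h2
  have h3 : (#{x ∈ S | (#{y ∈ Y | R x y} : ℝ) < c * #Y} : ℝ) +
    #{x ∈ S | c * #Y ≤ (#{y ∈ Y | R x y} : ℝ)} = #S := mod_cast h2
  linarith

lemma exists_high_degree_left_right {α β γ : Type*} {R : α → β → Prop}
    {Q : γ → α → Prop} [∀ a b, Decidable (R a b)] [∀ a b, Decidable (Q a b)] {c t : ℝ}
    {S : Finset α} {T : Finset β} {U : Finset γ} (hR : DenseBetween R c t S T)
    (hQ : DenseBetween Q c t U S) (ht : 0 < t) (hS : 2 * t < #S) (hT : t ≤ #T) (hU : t ≤ #U) :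
    ∃ x ∈ S, c * #T ≤ (#{y ∈ T | R x y} : ℝ) ∧ c * #U ≤ (#{z ∈ U | Q z x} : ℝ) := by
  classical
  by_contra! hx
  have h1 := hR.card_low_degree_lt ht Subset.rfl hT
  have h2 := hQ.swap.card_low_degree_lt ht Subset.rfl hU
  have h3 : S ⊆ {x ∈ S | (#{y ∈ T | R x y} : ℝ) < c * #T} ∪
      {x ∈ S | (#{z ∈ U | Q z x} : ℝ) < c * #U} := by
    intro x hxS
    rw [mem_union, mem_filter, mem_filter]
    by_cases h : (#{y ∈ T | R x y} : ℝ) < c * #T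
    · exact Or.inl ⟨hxS, h⟩
    · exact Or.inr ⟨hxS, hx x hxS (not_lt.1 h)⟩
  have h4 : (#S : ℝ) ≤ #{x ∈ S | (#{y ∈ T | R x y} : ℝ) < c * #T} +
      #{x ∈ S | (#{z ∈ U | Q z x} : ℝ) < c * #U} :=
    mod_cast (card_le_card h3).trans (card_union_le _ _)
  simp only [Function.swap] at h2
  linarith

variable {B S : ℕ → Finset G} {c s t : ℝ}

/-- Vertices reached from `u` by many walks of length `j + 1`. -/
lemma exists_many_walks {r : ℕ} {u : G} (hc : 0 < c) (ht : 0 < t) (hts : t ≤ c * s)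
    (hcs : c * s ≤ s - t) (hs : ∀ k ≤ r + 1, s ≤ #(S k))
    (hd : ∀ k ≤ r, DenseBetween (fun x y ↦ x⁻¹ * y ∈ B k) c t (S k) (S (k + 1)))
    (hu : c * #(S 1) ≤ (#{y ∈ S 1 | u⁻¹ * y ∈ B 0} : ℝ)) {j : ℕ} (hj : j ≤ r) :
    ∃ Y ⊆ S (j + 1), c * s ≤ #Y ∧
      ∀ y ∈ Y, (c * (c * s)) ^ j ≤ (prodCount B (j + 1) (u⁻¹ * y) : ℝ) := by
  have hs0 : 0 < c * s := ht.trans_le hts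
  induction j with
  | zero =>
    refine ⟨{y ∈ S 1 | u⁻¹ * y ∈ B 0}, filter_subset _ _, le_trans ?_ hu, fun y hy ↦ ?_⟩
    · have := hs 1 (by omega)
      gcongr
    · simp [prodCount, mul_inv_eq_one, (mem_filter.1 hy).2]
  | succ j ih =>
    obtain ⟨Y, hYS, hY, hw⟩ := ih (by omega)
    have hdj := (hd (j + 1) hj).swap
    refine ⟨_, filter_subset _ _, le_trans ?_ (hdj.le_card_high_degree ht hYS (hts.trans hY)), ?_⟩
    · have := hs (j + 1 + 1) (by omega)
      linarith
    · intro y hy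
      have hy2 := (mem_filter.1 hy).2
      simp only [Function.swap] at hy2
      calc (c * (c * s)) ^ (j + 1) = c * (c * s) * (c * (c * s)) ^ j := by ring
        _ ≤ (#{x ∈ Y | x⁻¹ * y ∈ B (j + 1)} : ℝ) * (c * (c * s)) ^ j := by
          gcongr
          exact le_trans (by gcongr) hy2
        _ = ∑ x ∈ Y with x⁻¹ * y ∈ B (j + 1), (c * (c * s)) ^ j := by
          rw [sum_const, nsmul_eq_mul]
        _ ≤ ∑ x ∈ Y with x⁻¹ * y ∈ B (j + 1), (prodCount B (j + 1) (u⁻¹ * x) : ℝ) :=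
          sum_le_sum fun x hx ↦ hw x (mem_filter.1 hx).1
        _ ≤ _ := mod_cast sum_prodCount_le_prodCount_succ B (j + 1) u y Y

/-- Counting lemma for cycles of length `r + 3`. -/
lemma le_prodCount_of_denseBetween {r : ℕ} (hc : 0 < c) (hc' : c ≤ 1 / 4) (ht : 0 < t)
    (hts : t ≤ c * s) (hS : S (r + 3) = S 0) (hs : ∀ k ≤ r + 3, s ≤ #(S k))
    (hd : ∀ k < r + 3, DenseBetween (fun x y ↦ x⁻¹ * y ∈ B k) c t (S k) (S (k + 1))) :
    c ^ (2 * r + 3) * s ^ (r + 2) ≤ (prodCount B (r + 3) 1 : ℝ) := by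
  have hs0 : 0 < s := pos_of_mul_pos_right (ht.trans_le hts) hc.le
  have hcs : c * s ≤ s / 4 := by nlinarith
  have hcs0 : 0 < c * s := mul_pos hc hs0
  have hlast := hd (r + 2) (by omega)
  rw [hS] at hlast
  have h0 := hs 0 (by omega)
  have h1 := hs 1 (by omega)
  have h2 := hs (r + 2) (by omega)
  obtain ⟨u, -, hu1, hu2⟩ := exists_high_degree_left_right (hd 0 (by omega)) hlast ht
    (by linarith) (by simp only [zero_add]; linarith) (by linarith)
  obtain ⟨Y, hYS, hY, hw⟩ := exists_many_walks (r := r) hc ht hts (by linarith)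
    (fun k hk ↦ hs k (by omega)) (fun k hk ↦ hd k (by omega)) hu1 le_rfl
  set Z : Finset G := {z ∈ S (r + 2) | z⁻¹ * u ∈ B (r + 2)} with hZ
  have hZc : c * s ≤ #Z := le_trans (by gcongr) hu2
  have hYZ := (hd (r + 1) (by omega)).swap Z (filter_subset _ _) Y hYS
    (hts.trans hZc) (hts.trans hY)
  simp only [Function.swap] at hYZ
  have hfin := sum_prodCount_le_prodCount_succ B (r + 2) u u (S (r + 2))
  rw [inv_mul_cancel, ← hZ] at hfin
  calc c ^ (2 * r + 3) * s ^ (r + 2) = c * (c * s) * (c * s) * (c * (c * s)) ^ r := by ring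
    _ ≤ c * #Z * #Y * (c * (c * s)) ^ r := by gcongr
    _ ≤ (∑ z ∈ Z, (#{x ∈ Y | x⁻¹ * z ∈ B (r + 1)} : ℝ)) * (c * (c * s)) ^ r := by gcongr
    _ = ∑ z ∈ Z, ∑ x ∈ Y with x⁻¹ * z ∈ B (r + 1), (c * (c * s)) ^ r := by
      rw [sum_mul]
      simp only [sum_const, nsmul_eq_mul]
    _ ≤ ∑ z ∈ Z, ∑ x ∈ Y with x⁻¹ * z ∈ B (r + 1), (prodCount B (r + 1) (u⁻¹ * x) : ℝ) :=
      sum_le_sum fun z _ ↦ sum_le_sum fun x hx ↦ hw x (mem_filter.1 hx).1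
    _ ≤ ∑ z ∈ Z, (prodCount B (r + 2) (u⁻¹ * z) : ℝ) :=
      sum_le_sum fun z _ ↦ mod_cast sum_prodCount_le_prodCount_succ B (r + 1) u z Y
    _ ≤ _ := mod_cast hfin

end CycleCounting

section Regularity

open SimpleGraph

lemma SimpleGraph.IsUniform.denseBetween {V : Type*} {Γ : SimpleGraph V} [DecidableRel Γ.Adj]
    {e d t : ℝ} {U W : Finset V}
    (h : Γ.IsUniform e U W) (hd : d ≤ Γ.edgeDensity U W) (ht : 0 < t)
    (hU : #U * e ≤ t) (hW : #W * e ≤ t) : DenseBetween Γ.Adj (d - e) t U W := by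
  intro X hX Y hY htX htY
  have h1 := (abs_lt.1 (h hX hY (hU.trans htX) (hW.trans htY))).1
  have h2 : (Γ.edgeDensity X Y : ℝ) * (#X * #Y) = ∑ x ∈ X, (#{y ∈ Y | Γ.Adj x y} : ℝ) := by
    have hX0 : (#X : ℝ) ≠ 0 := (ht.trans_le htX).ne'
    have hY0 : (#Y : ℝ) ≠ 0 := (ht.trans_le htY).ne'
    rw [edgeDensity_def]
    push_cast
    rw [div_mul_cancel₀ _ (mul_ne_zero hX0 hY0), interedges_def, card_filter, sum_product]
    simp only [card_filter]
    push_cast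
    rfl
  rw [← h2, mul_assoc]
  gcongr
  linarith

variable {V ι : Type*} [Fintype V] [DecidableEq V] [Fintype ι] [DecidableEq ι]
  {Γ : SimpleGraph V} [DecidableRel Γ.Adj] {P : Finpartition (univ : Finset V)}

lemma card_filter_not_regularityReduced_le [Nonempty V] {e d γ : ℝ} (he : 0 < e) (hd : 0 ≤ d)
    (hγ : 0 < γ) (hP : P.IsEquipartition) (hPe : P.IsUniform Γ e) (hP' : 4 / γ ≤ #P.parts) :
    (#{p : V × V | Γ.Adj p.1 p.2 ∧ ¬(Γ.regularityReduced P e d).Adj p.1 p.2} : ℝ) ≤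
      (4 * e + γ / 2 + 4 * d) * Fintype.card V ^ 2 := by
  let A := (P.nonUniforms Γ e).biUnion fun (U, W) ↦ U ×ˢ W
  let B := P.parts.biUnion offDiag
  let C := (P.sparsePairs Γ d).biUnion fun (U, W) ↦ Γ.interedges U W
  have hsub : ({p : V × V | Γ.Adj p.1 p.2 ∧ ¬(Γ.regularityReduced P e d).Adj p.1 p.2} :
      Finset (V × V)) ⊆ A ∪ B ∪ C := by
    rintro ⟨x, y⟩
    simp only [A, B, C, mem_filter, regularityReduced_adj, not_and, not_exists, mem_univ, true_and,
      not_le, mem_biUnion, mem_union, mem_product, Prod.exists, mem_offDiag, and_imp,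
      or_assoc, and_assoc, P.mk_mem_nonUniforms, Finpartition.mk_mem_sparsePairs,
      mem_interedges_iff]
    intro h h'
    replace h' := h' h
    obtain ⟨U, hU, hx⟩ := P.exists_mem (mem_univ x)
    obtain ⟨W, hW, hy⟩ := P.exists_mem (mem_univ y)
    obtain rfl | hUW := eq_or_ne U W
    · exact Or.inr (Or.inl ⟨U, hU, hx, hy, Γ.ne_of_adj h⟩)
    by_cases h₂ : Γ.IsUniform e U W
    · exact Or.inr <| Or.inr ⟨U, W, hU, hW, hUW, h' _ hU _ hW hx hy hUW h₂, hx, hy, h⟩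
    · exact Or.inl ⟨U, W, hU, hW, hUW, h₂, hx, hy⟩
  have hA := (hP.sum_nonUniforms_lt univ_nonempty he hPe).le
  have hB := hP.card_biUnion_offDiag_le hγ hP'
  have hC := hP.card_interedges_sparsePairs_le (G := Γ) hd
  rw [card_univ] at hA hB hC
  calc _ ≤ (#(A ∪ B ∪ C) : ℝ) := mod_cast card_le_card hsub
    _ ≤ #A + #B + #C := mod_cast (card_union_le _ _).trans (by gcongr; exact card_union_le _ _)
    _ ≤ 4 * e * Fintype.card V ^ 2 + γ / 2 * Fintype.card V ^ 2 + 4 * d * Fintype.card V ^ 2 := by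
      gcongr
    _ = _ := by ring

/-- Few vertices lie in a small intersection of a part of `P` with a colour class. -/
lemma card_filter_card_part_inter_lt_le (P : Finpartition (univ : Finset V)) (col : V → ι)
    {s : ℝ} (hs : 0 ≤ s) :
    (#{v : V | (#{w ∈ P.part v | col w = col v} : ℝ) < s} : ℝ) ≤
      #P.parts * Fintype.card ι * s := by
  rw [card_eq_sum_card_fiberwise (f := fun v ↦ (P.part v, col v)) (t := P.parts ×ˢ univ)
    fun v _ ↦ by simp]
  push_cast
  refine (sum_le_card_nsmul _ _ s fun q _ ↦ ?_).trans_eq (by simp)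
  obtain h | ⟨v, hv⟩ := ({v ∈ {v : V | (#{w ∈ P.part v | col w = col v} : ℝ) < s} |
    (P.part v, col v) = q} : Finset V).eq_empty_or_nonempty
  · rw [h]; simpa using hs
  · simp only [mem_filter, mem_univ, true_and] at hv
    refine le_trans (Nat.cast_le.2 (card_le_card fun w hw ↦ ?_)) hv.1.le
    simp only [mem_filter, mem_univ, true_and] at hw ⊢
    have := hw.2.trans hv.2.symm
    rw [Prod.mk.injEq] at this
    exact ⟨this.1 ▸ P.mem_part (mem_univ w), this.2⟩

end Regularity

section CayleyCycle

open SimpleGraph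

variable {G : Type*} [Group G] [Fintype G] [DecidableEq G]

/-- The graph on `m` copies of `G` arranged cyclically, in which `x` in the copy `i` is joined to
`x * b` in the copy `i + 1` for each `b ∈ B i`. -/
def cayleyCycle (m : ℕ) (B : ℕ → Finset G) : SimpleGraph (ZMod m × G) :=
  .fromRel fun p q ↦ q.1 = p.1 + 1 ∧ p.2⁻¹ * q.2 ∈ B p.1.val

omit [Fintype G] [DecidableEq G] in
lemma cayleyCycle_adj {r k : ℕ} {B : ℕ → Finset G} (hk : k < r + 3) (x y : G) :
    (cayleyCycle (r + 3) B).Adj ((k : ℕ), x) ((k + 1 : ℕ), y) ↔ x⁻¹ * y ∈ B k := by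
  have : Fact (1 < r + 3) := ⟨by omega⟩
  have h2 : (1 + 1 : ZMod (r + 3)) ≠ 0 := by
    intro h
    have : ((2 : ℕ) : ZMod (r + 3)) = 0 := by rw [← h]; norm_num
    rw [ZMod.natCast_eq_zero_iff] at this
    exact absurd (Nat.le_of_dvd two_pos this) (by omega)
  have h3 : (k : ZMod (r + 3)) ≠ k + 1 + 1 := by
    rw [add_assoc]; exact fun h ↦ h2 (by simpa using h)
  simp [cayleyCycle, ZMod.val_natCast_of_lt hk, h3]

lemma le_prodCount_of_reduced_cycle {r : ℕ} {B : ℕ → Finset G}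
    [DecidableRel (cayleyCycle (r + 3) B).Adj]
    {P : Finpartition (univ : Finset (ZMod (r + 3) × G))} {c d e s t : ℝ}
    (hc : 0 < c) (hc' : c ≤ 1 / 4) (hcd : c + e ≤ d) (ht : 0 < t) (hts : t ≤ c * s)
    (hP : ∀ U ∈ P.parts, #U * e ≤ t) {w : ℕ → G} (hw : w (r + 3) = w 0)
    (hs : ∀ k < r + 3, s ≤ #{q ∈ P.part ((k : ℕ), w k) | q.1 = (k : ZMod (r + 3))})
    (hadj : ∀ k < r + 3, ((cayleyCycle (r + 3) B).regularityReduced P e d).Adj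
      ((k : ℕ), w k) ((k + 1 : ℕ), w (k + 1))) :
    c ^ (2 * r + 3) * s ^ (r + 2) ≤ (prodCount B (r + 3) 1 : ℝ) := by
  set S : ℕ → Finset G := fun k ↦ {y | ((k : ZMod (r + 3)), y) ∈ P.part ((k : ℕ), w k)} with hS
  have hcast : ((r + 3 : ℕ) : ZMod (r + 3)) = (0 : ℕ) := by simp
  have hSlast : S (r + 3) = S 0 := by
    simp only [hS, hw, hcast]
  have hSs : ∀ k < r + 3, s ≤ #(S k) := by
    intro k hk
    refine (hs k hk).trans (Nat.cast_le.2 ?_)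
    rw [← card_map ⟨fun y : G ↦ ((k : ZMod (r + 3)), y), Prod.mk_right_injective _⟩]
    refine card_le_card fun q hq ↦ ?_
    obtain ⟨i, y⟩ := q
    simp only [mem_filter] at hq
    obtain ⟨hq, rfl⟩ := hq
    simpa [hS] using hq
  refine le_prodCount_of_denseBetween hc hc' ht hts hSlast (fun k hk ↦ ?_) fun k hk ↦ ?_
  · obtain hk | rfl := hk.lt_or_eq
    · exact hSs k hk
    · rw [hSlast]; exact hSs 0 (by omega)
  · obtain ⟨-, U, hU, W, hW, hkU, hkW, -, hUW, hd⟩ := hadj k hk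
    have hde := hUW.denseBetween hd ht (hP U hU) (hP W hW)
    rw [← P.part_eq_iff_mem hU] at hkU
    rw [← P.part_eq_iff_mem hW] at hkW
    intro X hX Y hY htX htY
    have h := hde (X.map ⟨fun y : G ↦ ((k : ZMod (r + 3)), y), Prod.mk_right_injective _⟩) ?_
      (Y.map ⟨fun y : G ↦ (((k + 1 : ℕ) : ZMod (r + 3)), y), Prod.mk_right_injective _⟩) ?_
      (by rwa [card_map]) (by rwa [card_map])
    · simp only [sum_map, card_map, filter_map, Function.Embedding.coeFn_mk,
        Function.comp_def] at h
      simp_rw [cayleyCycle_adj hk] at h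
      refine le_trans ?_ h
      gcongr
      linarith
    · intro q hq
      obtain ⟨y, hy, rfl⟩ := mem_map.1 hq
      have := hX hy
      simp only [hS, hkU, mem_filter] at this
      exact this.2
    · intro q hq
      obtain ⟨y, hy, rfl⟩ := mem_map.1 hq
      have := hY hy
      simp only [hS, hkW, mem_filter] at this
      exact this.2

omit [Fintype G] in
lemma one_le_prodCount {B : ℕ → Finset G} {w : ℕ → G} {k : ℕ}
    (h : ∀ i < k, (w i)⁻¹ * w (i + 1) ∈ B i) : 1 ≤ prodCount B k ((w 0)⁻¹ * w k) := by
  induction k with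
  | zero => simp [prodCount]
  | succ k ih =>
    refine (ih fun i hi ↦ h i (hi.trans k.lt_succ_self)).trans
      (le_trans ?_ (sum_prodCount_le_prodCount_succ B k (w 0) (w (k + 1)) {w k}))
    simp [filter_singleton, h k k.lt_succ_self]

/-- Removal lemma for the cycles of a Cayley cycle graph. -/
theorem exists_cayleyCycle_removal {η : ℝ} (hη : 0 < η) (hη1 : η ≤ 1) (r : ℕ) :
    ∃ δ : ℝ, 0 < δ ∧ ∀ (G : Type) [Group G] [Fintype G] [DecidableEq G] (B : ℕ → Finset G),
      (prodCount B (r + 3) 1 : ℝ) ≤ δ * (Fintype.card G : ℝ) ^ (r + 2) →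
      ∃ D : Finset ((ZMod (r + 3) × G) × (ZMod (r + 3) × G)),
        (#D : ℝ) ≤ η * ((r + 3) * Fintype.card G) ^ 2 ∧
        ∀ w : ℕ → G, w (r + 3) = w 0 → (∀ k < r + 3, (w k)⁻¹ * w (k + 1) ∈ B k) →
          ∃ k < r + 3, (((k : ZMod (r + 3)), w k), (((k + 1 : ℕ) : ZMod (r + 3)), w (k + 1))) ∈ D := by
  classical
  obtain ⟨d, hd⟩ : ∃ d, d = η / 16 := ⟨_, rfl⟩
  obtain ⟨c, hc⟩ : ∃ c, c = η / 32 := ⟨_, rfl⟩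
  obtain ⟨σ, hσ⟩ : ∃ σ, σ = η / (8 * (r + 3)) := ⟨_, rfl⟩
  obtain ⟨e, he⟩ : ∃ e, e = c * σ / 2 := ⟨_, rfl⟩
  have hc0 : 0 < c := by rw [hc]; positivity
  have hσ0 : 0 < σ := by rw [hσ]; positivity
  have he0 : 0 < e := by rw [he]; positivity
  have hσm : (r + 3) * σ = η / 8 := by rw [hσ]; field_simp
  have hr0 : (0 : ℝ) ≤ r := r.cast_nonneg
  have hσ1 : σ ≤ 1 := by nlinarith
  have hec : e ≤ c / 2 := by rw [he]; nlinarith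
  set l : ℕ := ⌈4 / (η / 2)⌉₊ with hl
  have hl0 : 0 < l := Nat.ceil_pos.2 (by positivity)
  set b : ℕ := SzemerediRegularity.bound e l with hb
  have hb0 : 0 < b := SzemerediRegularity.bound_pos e l
  set δ₁ : ℝ := c ^ (2 * r + 3) * (σ / (2 * b)) ^ (r + 2) with hδ₁
  have hδ₁0 : 0 < δ₁ := by positivity
  refine ⟨min (δ₁ / 2) (((l : ℝ) ^ (r + 2))⁻¹ / 2), by positivity, ?_⟩
  intro G _ _ _ B hB
  have hN : 0 < Fintype.card G := Fintype.card_pos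
  have hV : Fintype.card (ZMod (r + 3) × G) = (r + 3) * Fintype.card G := by
    rw [Fintype.card_prod, ZMod.card]
  have hVR : (Fintype.card (ZMod (r + 3) × G) : ℝ) = (r + 3) * Fintype.card G := by
    rw [hV]; push_cast; rfl
  obtain hsmall | hlarge := lt_or_ge (Fintype.card (ZMod (r + 3) × G)) l
  · refine ⟨∅, by simp; positivity, fun w hw hwB ↦ ?_⟩
    have h1 := one_le_prodCount hwB
    rw [hw, inv_mul_cancel] at h1
    have hNl : (Fintype.card G : ℝ) ≤ l := by
      rw [hV] at hsmall
      exact_mod_cast (by nlinarith : Fintype.card G ≤ l)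
    have h2 : (prodCount B (r + 3) 1 : ℝ) ≤ 1 / 2 := by
      calc _ ≤ _ := hB
        _ ≤ ((l : ℝ) ^ (r + 2))⁻¹ / 2 * (l : ℝ) ^ (r + 2) := by
          gcongr
          exact min_le_right _ _
        _ = 1 / 2 := by field_simp
    have h3 : (1 : ℝ) ≤ prodCount B (r + 3) 1 := mod_cast h1
    linarith
  obtain ⟨P, hPeq, hPl, hPb, hPe⟩ :=
    szemeredi_regularity (cayleyCycle (r + 3) B) he0 hlarge
  set n : ℕ := Fintype.card (ZMod (r + 3) × G) / #P.parts with hn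
  have hM0 : 0 < #P.parts := hl0.trans_le hPl
  have hMV : #P.parts ≤ Fintype.card (ZMod (r + 3) × G) := by
    simpa using P.card_parts_le_card
  have hn1 : 1 ≤ n := (Nat.one_le_div_iff hM0).2 hMV
  have hMn : #P.parts * n ≤ Fintype.card (ZMod (r + 3) × G) := Nat.mul_div_le _ _
  have hNbn : Fintype.card G ≤ 2 * b * n := by
    have h1 : Fintype.card (ZMod (r + 3) × G) < #P.parts * (n + 1) := Nat.lt_mul_div_succ _ hM0
    calc Fintype.card G ≤ (r + 3) * Fintype.card G := by nlinarith
      _ ≤ #P.parts * (n + 1) := by rw [← hV]; exact h1.le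
      _ ≤ b * (2 * n) := Nat.mul_le_mul hPb (by omega)
      _ = _ := by ring
  have hn1R : (1 : ℝ) ≤ n := mod_cast hn1
  set s : ℝ := σ * n with hs
  set D₁ : Finset ((ZMod (r + 3) × G) × (ZMod (r + 3) × G)) :=
    {p | (cayleyCycle (r + 3) B).Adj p.1 p.2 ∧
      ¬((cayleyCycle (r + 3) B).regularityReduced P e d).Adj p.1 p.2} with hD₁
  set D₂ : Finset (ZMod (r + 3) × G) := {v | (#{q ∈ P.part v | q.1 = v.1} : ℝ) < s} with hD₂
  refine ⟨D₁ ∪ D₂ ×ˢ univ ∪ univ ×ˢ D₂, ?_, fun w hw hwB ↦ ?_⟩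
  · have h1 : (#D₁ : ℝ) ≤ _ := card_filter_not_regularityReduced_le (d := d) he0
      (by rw [hd]; positivity) (by positivity : 0 < η / 2) hPeq hPe
      ((Nat.le_ceil _).trans (Nat.cast_le.2 hPl))
    have h2 : (#D₂ : ℝ) ≤ _ := card_filter_card_part_inter_lt_le P Prod.fst (by positivity : 0 ≤ s)
    have h3 : (#D₂ : ℝ) ≤ η / 8 * Fintype.card (ZMod (r + 3) × G) := by
      calc _ ≤ _ := h2
        _ = (r + 3) * σ * (#P.parts * n : ℕ) := by rw [ZMod.card, hs]; push_cast; ring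
        _ ≤ _ := by rw [hσm]; gcongr
    rw [← hVR]
    calc (#(D₁ ∪ D₂ ×ˢ univ ∪ univ ×ˢ D₂) : ℝ) ≤ #D₁ + #(D₂ ×ˢ univ) + #(univ ×ˢ D₂) :=
        mod_cast (card_union_le _ _).trans (by gcongr; exact card_union_le _ _)
      _ = #D₁ + 2 * #D₂ * Fintype.card (ZMod (r + 3) × G) := by
        rw [card_product, card_product, card_univ]; push_cast; ring
      _ ≤ (4 * e + η / 2 / 2 + 4 * d) * Fintype.card (ZMod (r + 3) × G) ^ 2 +
          2 * (η / 8 * Fintype.card (ZMod (r + 3) × G)) * Fintype.card (ZMod (r + 3) × G) := by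
        gcongr
      _ = (4 * e + η / 2 / 2 + 4 * d + η / 4) * Fintype.card (ZMod (r + 3) × G) ^ 2 := by ring
      _ ≤ _ := by
        gcongr
        linarith
  · by_contra! hD
    have hcyc := le_prodCount_of_reduced_cycle (P := P) (d := d) (e := e) (s := s)
      (t := 2 * e * n) hc0 (by linarith) (by linarith) (by positivity)
      (by rw [hs, he]; linarith) ?_ hw ?_ ?_ (B := B)
    · have h1 : (σ / (2 * b)) * Fintype.card G ≤ s := by
        have : (Fintype.card G : ℝ) ≤ 2 * b * n := mod_cast hNbn
        calc _ ≤ (σ / (2 * b)) * (2 * b * n) := by gcongr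
          _ = s := by rw [hs]; field_simp
      have h2 : δ₁ * Fintype.card G ^ (r + 2) ≤ δ₁ / 2 * Fintype.card G ^ (r + 2) := by
        calc _ = c ^ (2 * r + 3) * ((σ / (2 * b)) * Fintype.card G) ^ (r + 2) := by
              rw [hδ₁]; ring
          _ ≤ c ^ (2 * r + 3) * s ^ (r + 2) := by gcongr
          _ ≤ _ := hcyc
          _ ≤ _ := hB
          _ ≤ _ := by gcongr; exact min_le_left _ _
      have h3 : 0 < δ₁ * (Fintype.card G : ℝ) ^ (r + 2) := by positivity
      linarith
    · intro U hU
      have h1 : (#U : ℝ) ≤ n + 1 := by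
        have := hPeq.card_part_le_average_add_one hU
        rw [card_univ] at this
        exact_mod_cast this
      nlinarith
    · intro k hk
      have := hD k hk
      simp only [mem_union, mem_product, mem_univ, and_true, true_and, not_or, hD₂, mem_filter,
        not_lt] at this
      exact this.1.2
    · intro k hk
      have := hD k hk
      simp only [mem_union, not_or, hD₁, mem_filter, mem_univ, true_and, not_and, not_not] at this
      exact this.1.1 ((cayleyCycle_adj hk _ _).2 (hwB k hk))


theorem exists_prod_one_removal {ε : ℝ} (hε : 0 < ε) (r : ℕ) :
    ∃ δ : ℝ, 0 < δ ∧ ∀ (G : Type) [Group G] [Fintype G] [DecidableEq G] (B : ℕ → Finset G),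
      (prodCount B (r + 3) 1 : ℝ) ≤ δ * (Fintype.card G : ℝ) ^ (r + 2) →
      ∃ B' : ℕ → Finset G, (∀ k < r + 3, (#(B k \ B' k) : ℝ) ≤ ε * Fintype.card G) ∧
        ∀ w : ℕ → G, w (r + 3) = w 0 →
          ¬∀ k < r + 3, (w k)⁻¹ * w (k + 1) ∈ B k ∩ B' k := by
  obtain ⟨δ, hδ, H⟩ := exists_cayleyCycle_removal (η := min 1 (ε / (r + 3) ^ 3))
    (by positivity) (min_le_left _ _) r
  refine ⟨δ, hδ, fun G _ _ _ B hB ↦ ?_⟩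
  obtain ⟨D, hDcard, hD⟩ := H G B hB
  have hN : 0 < Fintype.card G := Fintype.card_pos
  set F : ℕ → G → Finset G := fun k x ↦
    {h | (((k : ZMod (r + 3)), h), (((k + 1 : ℕ) : ZMod (r + 3)), h * x)) ∈ D} with hF
  refine ⟨fun k ↦ {x | (r + 3) * #(F k x) < Fintype.card G}, fun k _ ↦ ?_, fun w hw hwB ↦ ?_⟩
  · set E : Finset G := B k \ ({x | (r + 3) * #(F k x) < Fintype.card G} : Finset G) with hE
    have h1 : ∑ x ∈ E, #(F k x) ≤ #D := by
      rw [← card_sigma]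
      refine card_le_card_of_injOn
        (fun p ↦ (((k : ZMod (r + 3)), p.2), (((k + 1 : ℕ) : ZMod (r + 3)), p.2 * p.1))) ?_ ?_
      · rintro ⟨x, h⟩ hx
        simp only [coe_sigma, Set.mem_sigma_iff, mem_coe, hF, mem_filter] at hx
        exact hx.2.2
      · rintro ⟨x, h⟩ _ ⟨y, h'⟩ _ hxy
        simp only [Prod.mk.injEq, true_and] at hxy
        obtain ⟨rfl, hxy⟩ := hxy
        simpa using hxy
    have h2 : #E * Fintype.card G ≤ (r + 3) * ∑ x ∈ E, #(F k x) := by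
      rw [mul_sum, ← smul_eq_mul (a := #E)]
      refine card_nsmul_le_sum _ _ _ fun x hx ↦ ?_
      simpa using (mem_sdiff.1 hx).2
    have h3 : (#E : ℝ) * Fintype.card G ≤ (r + 3) * #D :=
      mod_cast h2.trans (Nat.mul_le_mul_left _ h1)
    have h4 : (#E : ℝ) * Fintype.card G ≤ ε * Fintype.card G * Fintype.card G := by
      calc _ ≤ _ := h3
        _ ≤ (r + 3) * (ε / (r + 3) ^ 3 * ((r + 3) * Fintype.card G) ^ 2) := by
          gcongr
          refine hDcard.trans ?_
          gcongr
          exact min_le_right _ _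
        _ = _ := by field_simp
    exact le_of_mul_le_mul_right h4 (Nat.cast_pos.2 hN)
  · have h1 : (univ : Finset G) ⊆ (range (r + 3)).biUnion
        fun k ↦ {h | h * w k ∈ F k ((w k)⁻¹ * w (k + 1))} := by
      intro h _
      obtain ⟨k, hk, hkD⟩ := hD (fun k ↦ h * w k) (by simp only [hw]) fun k hk ↦ by
        simpa [mul_assoc] using (mem_inter.1 (hwB k hk)).1
      refine mem_biUnion.2 ⟨k, mem_range.2 hk, ?_⟩
      simpa [hF, mul_assoc] using hkD
    have h2 : ∀ k, #{h | h * w k ∈ F k ((w k)⁻¹ * w (k + 1))} = #(F k ((w k)⁻¹ * w (k + 1))) :=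
      fun k ↦ card_bij (fun h _ ↦ h * w k) (fun h hh ↦ (mem_filter.1 hh).2)
        (fun _ _ _ _ h ↦ mul_right_cancel h) fun h hh ↦ ⟨h * (w k)⁻¹, by simpa using hh, by simp⟩
    have h3 : Fintype.card G ≤ ∑ k ∈ range (r + 3), #(F k ((w k)⁻¹ * w (k + 1))) := by
      rw [← card_univ]
      exact ((card_le_card h1).trans card_biUnion_le).trans_eq (sum_congr rfl fun k _ ↦ h2 k)
    have h4 : ∑ k ∈ range (r + 3), (r + 3) * #(F k ((w k)⁻¹ * w (k + 1))) <
        ∑ k ∈ range (r + 3), Fintype.card G :=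
      sum_lt_sum_of_nonempty (by simp) fun k hk ↦ by
        simpa using (mem_inter.1 (hwB k (mem_range.1 hk))).2
    rw [← mul_sum, sum_const, card_range, smul_eq_mul] at h4
    exact absurd (Nat.lt_of_mul_lt_mul_left h4) h3.not_gt

end CayleyCycle

section Removal

variable {G : Type*} [Group G] [DecidableEq G]

/-- Right multiplication of the last factor by `g⁻¹` turns solutions of `a₀ ⋯ aₙ = g` into
solutions of `a₀ ⋯ aₙ = 1`. -/
lemma prodCount_image_mul_inv (B : ℕ → Finset G) (n : ℕ) (g : G) :
    prodCount (fun k ↦ (B k).image (· * if k = n then g⁻¹ else 1)) (n + 1) 1 =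
      prodCount B (n + 1) g := by
  simp only [prodCount, if_true]
  rw [sum_image fun x _ y _ h ↦ mul_right_cancel h]
  refine sum_congr rfl fun a _ ↦ ?_
  rw [prodCount_congr (B' := B) fun i hi ↦ by simp [hi.ne]]
  simp

lemma exists_removal_two [Fintype G] {ε : ℝ} (g : G) (A : Fin 2 → Finset G)
    (hA : (#{x ∈ Fintype.piFinset A | (List.ofFn x).prod = g} : ℝ) ≤ ε * Fintype.card G) :
    ∃ A' : Fin 2 → Finset G, (∀ i, A' i ⊆ A i) ∧
      (∀ i, (#(A i \ A' i) : ℝ) ≤ ε * Fintype.card G) ∧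
      ¬∃ x : Fin 2 → G, (∀ i, x i ∈ A' i) ∧ (List.ofFn x).prod = g := by
  refine ⟨![{x ∈ A 0 | x⁻¹ * g ∉ A 1}, A 1], ?_, ?_, ?_⟩
  · simp [Fin.forall_fin_two]
  · have h0 := (Nat.cast_nonneg _).trans hA
    refine Fin.forall_fin_two.2 ⟨le_trans (Nat.cast_le.2 ?_) hA, by simpa using h0⟩
    refine card_le_card_of_injOn (fun x ↦ ![x, x⁻¹ * g]) ?_ ?_
    · intro x hx
      have hx' : x ∈ A 0 ∧ (x ∈ A 0 → x⁻¹ * g ∈ A 1) := by simpa using hx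
      simpa [Fin.forall_fin_two] using And.intro hx'.1 (hx'.2 hx'.1)
    · intro x _ y _ h
      simpa using congrFun h 0
  · rintro ⟨x, hx, rfl⟩
    have h0 := hx 0
    have h1 := hx 1
    simp at h0 h1
    exact h0.2 h1

end Removal

/-- **Removal Lemma for (not necessarily abelian) finite groups**.
For every `ε > 0` and every integer `m ≥ 2` there is a `δ > 0` (depending only on
`ε` and `m`) such that for every finite group `G` of order `N`, every `g ∈ G` and
subsets `A₁, …, A_m` of `G`: if the number of tuples `(x₁, …, x_m) ∈ A₁ × ⋯ × A_m`
with `x₁x₂⋯x_m = g` (product taken in this order) is at most `δ·N^(m-1)`, then one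
can pass to subsets `A′ᵢ ⊆ Aᵢ` with `|Aᵢ \ A′ᵢ| ≤ ε·N` admitting no such solution. -/
theorem removal_lemma_groups :
    ∀ ε : ℝ, 0 < ε → ∀ m : ℕ, 2 ≤ m → ∃ δ : ℝ, 0 < δ ∧
      ∀ (G : Type) [Group G] [Fintype G] [DecidableEq G] (g : G)
        (A : Fin m → Finset G),
        ((((Fintype.piFinset A).filter
              (fun x : Fin m → G => (List.ofFn x).prod = g)).card : ℝ)
            ≤ δ * (Fintype.card G : ℝ) ^ (m - 1)) →
        ∃ A' : Fin m → Finset G,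
          (∀ i, A' i ⊆ A i) ∧
          (∀ i, (((A i) \ (A' i)).card : ℝ) ≤ ε * (Fintype.card G : ℝ)) ∧
          ¬ ∃ x : Fin m → G, (∀ i, x i ∈ A' i) ∧ (List.ofFn x).prod = g := by
  intro ε hε m hm
  obtain rfl | ⟨r, rfl⟩ : m = 2 ∨ ∃ r, m = r + 3 := by
    obtain rfl | h := hm.eq_or_lt
    · exact Or.inl rfl
    · exact Or.inr ⟨m - 3, by omega⟩
  · exact ⟨ε, hε, fun G _ _ _ g A hA ↦ exists_removal_two g A (by simpa using hA)⟩
  obtain ⟨δ, hδ, H⟩ := exists_prod_one_removal hε r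
  refine ⟨δ, hδ, fun G _ _ _ g A hA ↦ ?_⟩
  set B : ℕ → Finset G := fun k ↦ if h : k < r + 3 then A ⟨k, h⟩ else ∅ with hB
  set τ : ℕ → G := fun k ↦ if k = r + 2 then g⁻¹ else 1 with hτ
  have hBA : (fun i : Fin (r + 3) ↦ B i) = A := by ext i; simp [hB]
  obtain ⟨B', hB', hcyc⟩ := H G (fun k ↦ (B k).image (· * τ k)) (by
    rw [prodCount_image_mul_inv, ← card_filter_prod_eq_prodCount, hBA]
    exact hA)
  refine ⟨fun i ↦ {a ∈ A i | a * τ i ∈ B' i}, fun i ↦ filter_subset _ _, fun i ↦ ?_, ?_⟩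
  · refine le_trans (Nat.cast_le.2 ?_) (hB' i i.2)
    refine card_le_card_of_injOn (· * τ i) (fun a ha ↦ ?_) fun _ _ _ _ h ↦ mul_right_cancel h
    have ha' := ha
    simp only [coe_sdiff, Set.mem_sdiff, mem_coe, mem_filter, not_and] at ha'
    simp only [coe_sdiff, Set.mem_sdiff, mem_coe]
    exact ⟨mem_image_of_mem _ (by simpa [hB] using ha'.1), ha'.2 ha'.1⟩
  · rintro ⟨x, hx, hxg⟩
    set y : ℕ → G := fun k ↦ if h : k < r + 3 then x ⟨k, h⟩ else 1 with hy
    have hxy : List.ofFn x = (List.range (r + 3)).map y := by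
      refine List.ext_getElem (by simp) fun i hi _ ↦ ?_
      rw [List.length_ofFn] at hi
      rw [List.getElem_ofFn, List.getElem_map, List.getElem_range]
      simp only [hy, dif_pos hi]
    refine hcyc (fun k ↦ ((List.range k).map fun j ↦ y j * τ j).prod) ?_ fun k hk ↦ ?_
    · have h1 : (List.range (r + 2)).map (fun j ↦ y j * τ j) = (List.range (r + 2)).map y :=
        List.map_congr_left fun j hj ↦ by simp [hτ, (List.mem_range.1 hj).ne]
      rw [hxy, List.prod_range_succ] at hxg
      simp only [List.range_zero, List.map_nil, List.prod_nil]
      rw [List.prod_range_succ, h1, ← mul_assoc, hxg]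
      simp [hτ]
    · have h1 := mem_filter.1 (hx ⟨k, hk⟩)
      simp only [List.prod_range_succ, inv_mul_cancel_left]
      simp only [hy, hk, dif_pos]
      exact mem_inter.2 ⟨mem_image_of_mem _ (by simpa [hB, hk] using h1.1), h1.2⟩
end

section
/- For every fixed directed graph H on h vertices whose arcs are colored with colors from {1, …, m} and every ε > 0 there exists δ > 0 such that the following holds for every directed graph G on n vertices whose arcs are colored with colors from {1, …, m}: if G contains at most δ·n^h color-preserving copies of H (a color-preserving copy of H is an injective map from the vertices of H to the vertices of G sending every arc of H to an arc of G of the same color), then there exists a set E of at most ε·n² arcs of G such that the arc-colored directed graph obtained from G by removing the arcs of E contains no color-preserving copy of H. -/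
open Finset Classical in
/-- One-sided regularity of a bipartite relation: any two subsets of `A` and `B` of size at
least `c` span a density of at least `β`. -/
def LowerRegular {V : Type*} (r : V → V → Prop) (β c : ℝ) (A B : Finset V) : Prop :=
  ∀ X ⊆ A, ∀ Y ⊆ B, c ≤ #X → c ≤ #Y →
    β * (#X * #Y) ≤ ∑ x ∈ X, (#{y ∈ Y | r x y} : ℝ)

namespace LowerRegular

open Finset

variable {V : Type*} {r : V → V → Prop} {β c : ℝ} {A A' B B' : Finset V}

lemma mono (h : LowerRegular r β c A B) (hA : A' ⊆ A) (hB : B' ⊆ B) :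
    LowerRegular r β c A' B' :=
  fun X hX Y hY ↦ h X (hX.trans hA) Y (hY.trans hB)

open Classical in
lemma card_filter_lt (h : LowerRegular r β c A B) (hc : 0 < c) (hB : c ≤ #B)
    {X : Finset V} (hX : X ⊆ A)
    (hX' : ∀ x ∈ X, (#{y ∈ B | r x y} : ℝ) < β * #B) : (#X : ℝ) < c := by
  by_contra! hXc
  have hne : X.Nonempty := by
    rw [← card_pos]
    exact_mod_cast hc.trans_le hXc
  have h1 := h X hX B subset_rfl hXc hB
  have h2 := sum_lt_sum_of_nonempty hne hX'
  rw [sum_const, nsmul_eq_mul] at h2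
  linarith

end LowerRegular

open Finset in
/-- The counting lemma: a `k`-partite system of lower regular relations on large vertex classes
has many transversals. -/
lemma pow_le_card_transversals {V : Type*} [Fintype V] {β c : ℝ} (hβ : 0 < β) (hβ1 : β ≤ 1)
    (hc : 0 < c) (K : ℕ) : ∀ (k : ℕ), k ≤ K → ∀ (R : Fin k → Fin k → V → V → Prop)
    (W : Fin k → Finset V),
    (∀ i j, i < j → LowerRegular (R i j) β c (W i) (W j)) →
    (∀ i, (K + 1) * c / β ^ k ≤ #(W i)) →
    c ^ k ≤ Nat.card {f : Fin k → V // (∀ i, f i ∈ W i) ∧ ∀ i j, i < j → R i j (f i) (f j)} := by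
  classical
  intro k
  induction k with
  | zero => intro _ R W _ _; simp
  | succ k ih =>
    intro hk R W hreg hW
    have hkK : (k : ℝ) + 1 ≤ K := by exact_mod_cast hk
    have hW' : ∀ i, (K + 1) * c ≤ #(W i) := fun i ↦ by
      refine le_trans ?_ (hW i)
      rw [le_div_iff₀ (by positivity)]
      exact mul_le_of_le_one_right (by positivity) (pow_le_one₀ hβ.le hβ1)
    have hWc : ∀ i, c ≤ #(W i) := fun i ↦ by
      refine le_trans ?_ (hW' i)
      nlinarith
    let N (x : V) (j : Fin k) : Finset V := {y ∈ W j.succ | R 0 j.succ x y}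
    let bad (j : Fin k) : Finset V := {x ∈ W 0 | (#(N x j) : ℝ) < β * #(W j.succ)}
    let good : Finset V := {x ∈ W 0 | ∀ j, β * #(W j.succ) ≤ (#(N x j) : ℝ)}
    have hbad (j : Fin k) : (#(bad j) : ℝ) ≤ c := by
      refine ((hreg 0 j.succ (Fin.succ_pos j)).card_filter_lt hc (hWc _)
        (filter_subset _ _) fun x hx ↦ ?_).le
      convert (mem_filter.1 hx).2
    have hcover : W 0 ⊆ good ∪ univ.biUnion bad := by
      intro x hx
      by_cases hg : ∀ j, β * #(W j.succ) ≤ (#(N x j) : ℝ)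
      · exact mem_union_left _ (mem_filter.2 ⟨hx, hg⟩)
      · push Not at hg
        obtain ⟨j, hj⟩ := hg
        exact mem_union_right _ (mem_biUnion.2 ⟨j, mem_univ _, mem_filter.2 ⟨hx, hj⟩⟩)
    have hgood : c ≤ #good := by
      have h1 : #(W 0) ≤ #good + ∑ j, #(bad j) :=
        (card_le_card hcover).trans ((card_union_le _ _).trans
          (Nat.add_le_add_left card_biUnion_le _))
      have h2 : (∑ j, (#(bad j) : ℝ)) ≤ k * c := by
        simpa using sum_le_sum fun j (_ : j ∈ univ) ↦ hbad j
      have h3 : (#(W 0) : ℝ) ≤ #good + ∑ j, (#(bad j) : ℝ) := by exact_mod_cast h1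
      have h4 := hW' 0
      nlinarith
    let T (x : V) : Finset (Fin k → V) :=
      {f | (∀ i, f i ∈ N x i) ∧ ∀ i j, i < j → R i.succ j.succ (f i) (f j)}
    have hT (x : V) (hx : x ∈ good) : c ^ k ≤ #(T x) := by
      have := ih (by lia) (fun i j ↦ R i.succ j.succ) (N x)
        (fun i j hij ↦ (hreg _ _ (Fin.succ_lt_succ_iff.2 hij)).mono
          (filter_subset _ _) (filter_subset _ _))
        (fun i ↦ by
          refine le_trans ?_ ((mem_filter.1 hx).2 i)
          have := hW i.succ
          rw [div_le_iff₀ (by positivity)] at this ⊢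
          rw [pow_succ] at this
          linarith)
      refine this.trans_eq ?_
      rw [Nat.subtype_card (T x) (by simp [T])]
    have hcard : #(good.sigma T) ≤
        Nat.card {f : Fin (k + 1) → V // (∀ i, f i ∈ W i) ∧ ∀ i j, i < j → R i j (f i) (f j)} := by
      rw [Nat.card_eq_fintype_card, Fintype.card_subtype]
      refine card_le_card_of_injOn (fun p ↦ Fin.cons p.1 p.2) ?_ ?_
      · rintro ⟨x, f⟩ hp
        simp only [coe_sigma, Set.mem_sigma_iff, mem_coe] at hp
        obtain ⟨hx, hf⟩ := hp
        simp only [T, mem_filter, mem_univ, true_and, N] at hf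
        simp only [coe_filter, mem_univ, true_and, Set.mem_ofPred_eq]
        refine ⟨Fin.cases (mem_filter.1 hx).1 fun i ↦ (hf.1 i).1, Fin.cases ?_ ?_⟩
        · exact Fin.cases (fun h ↦ absurd h (lt_irrefl _)) fun j _ ↦ (hf.1 j).2
        · exact fun i ↦ Fin.cases (fun h ↦ absurd h (Fin.not_lt_zero _))
            fun j hij ↦ hf.2 i j (Fin.succ_lt_succ_iff.1 hij)
      · rintro ⟨x, f⟩ - ⟨y, g⟩ - h
        obtain ⟨rfl, rfl⟩ := Fin.cons_injective2 h
        rfl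
    calc c ^ (k + 1) = c * c ^ k := pow_succ' _ _
      _ ≤ #good * c ^ k := by gcongr
      _ = ∑ x ∈ good, c ^ k := by simp
      _ ≤ ∑ x ∈ good, (#(T x) : ℝ) := sum_le_sum hT
      _ = #(good.sigma T) := by simp
      _ ≤ _ := by exact_mod_cast hcard

open Finset in
lemma Finpartition.IsEquipartition.card_part_bounds {α : Type*} [DecidableEq α] {s : Finset α}
    {P : Finpartition s} (hP : P.IsEquipartition) {A : Finset α} (hA : A ∈ P.parts) :
    #s ≤ 2 * #P.parts * #A ∧ #P.parts * #A ≤ 2 * #s := by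
  have hK : 0 < #P.parts := card_pos.2 ⟨A, hA⟩
  have hKs : #P.parts ≤ #s := P.card_parts_le_card
  have h1 := hP.average_le_card_part hA
  have h2 := hP.card_part_le_average_add_one hA
  have h9 := Nat.mul_div_le (#s) (#P.parts)
  have h3 := Nat.div_add_mod (#s) (#P.parts)
  have h4 := Nat.mod_lt (#s) hK
  have h5 : 1 ≤ #s / #P.parts := (Nat.one_le_div_iff hK).2 hKs
  have h6 := Nat.mul_le_mul_left (#P.parts) h1
  have h7 := Nat.mul_le_mul_left (#P.parts) h2
  rw [Nat.mul_add] at h7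
  have h8 := Nat.mul_le_mul_left (#P.parts) h5
  constructor <;> linarith

section PartiteGraph

open Finset Classical

variable {h : ℕ} {V : Type*}

/-- The `h`-partite graph on `Fin h × V` whose bipartite pieces are the relations `R i j`,
`i < j`. -/
def partiteGraph (R : Fin h → Fin h → V → V → Prop) : SimpleGraph (Fin h × V) where
  Adj a b := (a.1 < b.1 ∧ R a.1 b.1 a.2 b.2) ∨ (b.1 < a.1 ∧ R b.1 a.1 b.2 a.2)
  symm := ⟨fun _ _ hab ↦ hab.symm⟩
  loopless := ⟨fun _ ha ↦ by simp at ha⟩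

/-- The trace of a subset of `Fin h × V` on the `i`-th copy of `V`. -/
noncomputable def partSlice [Fintype V] (i : Fin h) (A : Finset (Fin h × V)) : Finset V :=
  {x | (i, x) ∈ A}

@[simp]
lemma mem_partSlice [Fintype V] {i : Fin h} {A : Finset (Fin h × V)} {x : V} :
    x ∈ partSlice i A ↔ (i, x) ∈ A := by
  simp [partSlice]

lemma map_subset_of_subset_partSlice [Fintype V] {i : Fin h} {A : Finset (Fin h × V)}
    {X : Finset V} (hX : X ⊆ partSlice i A) : X.map (Function.Embedding.sectR i V) ⊆ A := by
  intro a ha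
  obtain ⟨x, hx, rfl⟩ := mem_map.1 ha
  exact mem_partSlice.1 (hX hx)

lemma edgeDensity_partiteGraph (R : Fin h → Fin h → V → V → Prop) {i j : Fin h} (hij : i < j)
    (X Y : Finset V) :
    ((partiteGraph R).edgeDensity (X.map (Function.Embedding.sectR i V))
      (Y.map (Function.Embedding.sectR j V)) : ℝ) =
      (∑ x ∈ X, (#{y ∈ Y | R i j x y} : ℝ)) / (#X * #Y) := by
  have key : #((partiteGraph R).interedges (X.map (Function.Embedding.sectR i V))
      (Y.map (Function.Embedding.sectR j V))) = ∑ x ∈ X, #{y ∈ Y | R i j x y} := by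
    rw [← card_sigma]
    symm
    refine card_bij (fun p _ ↦ ((i, p.1), (j, p.2))) ?_ ?_ ?_
    · rintro ⟨x, y⟩ hp
      simp only [mem_sigma, mem_filter] at hp
      rw [SimpleGraph.mk_mem_interedges_iff]
      exact ⟨mem_map_of_mem _ hp.1, mem_map_of_mem _ hp.2.1, Or.inl ⟨hij, hp.2.2⟩⟩
    · rintro ⟨x, y⟩ - ⟨x', y'⟩ - hp
      simp only [Prod.mk.injEq, true_and] at hp
      obtain ⟨rfl, rfl⟩ := hp
      rfl
    · rintro ⟨a, b⟩ hab
      rw [SimpleGraph.mk_mem_interedges_iff] at hab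
      obtain ⟨ha, hb, hadj⟩ := hab
      obtain ⟨x, hx, rfl⟩ := mem_map.1 ha
      obtain ⟨y, hy, rfl⟩ := mem_map.1 hb
      refine ⟨⟨x, y⟩, mem_sigma.2 ⟨hx, mem_filter.2 ⟨hy, ?_⟩⟩, rfl⟩
      rcases hadj with hadj | hadj
      · exact hadj.2
      · exact absurd hadj.1 hij.not_gt
  rw [SimpleGraph.edgeDensity_def, key]
  simp

lemma SimpleGraph.IsUniform.lowerRegular [Fintype V] {R : Fin h → Fin h → V → V → Prop}
    {i j : Fin h} (hij : i < j) {A B : Finset (Fin h × V)} {ε β c : ℝ}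
    (hu : (partiteGraph R).IsUniform ε A B) (hc : 0 < c)
    (hA : #A * ε ≤ #(partSlice i A)) (hB : #B * ε ≤ #(partSlice j B))
    (hAc : #A * ε ≤ c) (hBc : #B * ε ≤ c)
    (hd : (β + 2 * ε) * (#(partSlice i A) * #(partSlice j B)) ≤
      ∑ x ∈ partSlice i A, (#{y ∈ partSlice j B | R i j x y} : ℝ)) :
    LowerRegular (R i j) β c (partSlice i A) (partSlice j B) := by
  intro X hX Y hY hXc hYc
  have hX0 : (0 : ℝ) < #X := hc.trans_le hXc
  have hY0 : (0 : ℝ) < #Y := hc.trans_le hYc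
  have hXs : (#X : ℝ) ≤ #(partSlice i A) := by exact_mod_cast card_le_card hX
  have hYs : (#Y : ℝ) ≤ #(partSlice j B) := by exact_mod_cast card_le_card hY
  have h1 := hu (map_subset_of_subset_partSlice (subset_refl (partSlice i A)))
    (map_subset_of_subset_partSlice (subset_refl (partSlice j B)))
    (by simpa using hA) (by simpa using hB)
  have h2 := hu (map_subset_of_subset_partSlice hX) (map_subset_of_subset_partSlice hY)
    (by simpa using hAc.trans hXc) (by simpa using hBc.trans hYc)
  rw [edgeDensity_partiteGraph R hij, abs_lt] at h1 h2
  rw [← le_div_iff₀ (mul_pos (hX0.trans_le hXs) (hY0.trans_le hYs))] at hd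
  rw [← le_div_iff₀ (mul_pos hX0 hY0)]
  linarith [h1.1, h1.2, h2.1, h2.2]

variable [Fintype V] (P : Finpartition (univ : Finset (Fin h × V)))

lemma sum_card_partSlice (i : Fin h) : ∑ A ∈ P.parts, #(partSlice i A) = Fintype.card V := by
  rw [← card_biUnion]
  · rw [← card_univ]
    congr 1
    refine eq_univ_of_forall fun x ↦ mem_biUnion.2 ?_
    exact ⟨P.part (i, x), P.part_mem.2 (mem_univ _),
      mem_partSlice.2 (P.mem_part (mem_univ _))⟩
  · intro A hA B hB hAB
    refine Finset.disjoint_left.2 ?_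
    intro x hxA hxB
    exact Finset.disjoint_left.1 (P.disjoint hA hB hAB) (mem_partSlice.1 hxA)
      (mem_partSlice.1 hxB)

lemma card_small_partSlice_le (i : Fin h) {τ : ℝ} (hτ : 0 ≤ τ) :
    (#{x : V | (#(partSlice i (P.part (i, x))) : ℝ) < τ * #(P.part (i, x))} : ℝ) ≤
      τ * (h * Fintype.card V) := by
  have hsub : ({x : V | (#(partSlice i (P.part (i, x))) : ℝ) < τ * #(P.part (i, x))} : Finset V) ⊆
      {A ∈ P.parts | (#(partSlice i A) : ℝ) < τ * #A}.biUnion (partSlice i) := by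
    intro x hx
    rw [mem_biUnion]
    exact ⟨P.part (i, x), mem_filter.2 ⟨P.part_mem.2 (mem_univ _), (mem_filter.1 hx).2⟩,
      mem_partSlice.2 (P.mem_part (mem_univ _))⟩
  have h1 := (card_le_card hsub).trans card_biUnion_le
  calc _ ≤ ∑ A ∈ P.parts with (#(partSlice i A) : ℝ) < τ * #A, (#(partSlice i A) : ℝ) := by
        exact_mod_cast h1
    _ ≤ ∑ A ∈ P.parts with (#(partSlice i A) : ℝ) < τ * #A, τ * #A :=
        sum_le_sum fun A hA ↦ (mem_filter.1 hA).2.le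
    _ ≤ ∑ A ∈ P.parts, τ * #A :=
        sum_le_sum_of_subset_of_nonneg (filter_subset _ _) fun _ _ _ ↦ by positivity
    _ = τ * (∑ A ∈ P.parts, #A : ℕ) := by push_cast; rw [mul_sum]
    _ = _ := by rw [P.sum_card_parts]; simp

lemma card_sparse_partSlice_le (r : V → V → Prop) (i j : Fin h) {γ : ℝ} (hγ : 0 ≤ γ) :
    (#{p : V × V | r p.1 p.2 ∧
      ∑ x ∈ partSlice i (P.part (i, p.1)), (#{y ∈ partSlice j (P.part (j, p.2)) | r x y} : ℝ) <
        γ * (#(partSlice i (P.part (i, p.1))) * #(partSlice j (P.part (j, p.2))))} : ℝ) ≤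
      γ * (Fintype.card V : ℝ) ^ 2 := by
  let S : Finset (Finset (Fin h × V) × Finset (Fin h × V)) :=
    {Q ∈ P.parts ×ˢ P.parts | ∑ x ∈ partSlice i Q.1, (#{y ∈ partSlice j Q.2 | r x y} : ℝ) <
        γ * (#(partSlice i Q.1) * #(partSlice j Q.2))}
  have hsub : ({p : V × V | r p.1 p.2 ∧
      ∑ x ∈ partSlice i (P.part (i, p.1)), (#{y ∈ partSlice j (P.part (j, p.2)) | r x y} : ℝ) <
        γ * (#(partSlice i (P.part (i, p.1))) * #(partSlice j (P.part (j, p.2))))} :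
          Finset (V × V)) ⊆
      S.biUnion fun Q ↦ (partSlice i Q.1).biUnion fun x ↦
        {y ∈ partSlice j Q.2 | r x y}.image (Prod.mk x) := by
    rintro ⟨x, y⟩ hp
    obtain ⟨hr, hp⟩ := (mem_filter.1 hp).2
    simp only [mem_biUnion, mem_image, mem_filter]
    exact ⟨(P.part (i, x), P.part (j, y)), mem_filter.2 ⟨mem_product.2
      ⟨P.part_mem.2 (mem_univ _), P.part_mem.2 (mem_univ _)⟩, hp⟩, x,
      mem_partSlice.2 (P.mem_part (mem_univ _)), y,
      ⟨mem_partSlice.2 (P.mem_part (mem_univ _)), hr⟩, rfl⟩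
  have h1 := (card_le_card hsub).trans (card_biUnion_le.trans (sum_le_sum fun Q _ ↦
    card_biUnion_le.trans (sum_le_sum fun x _ ↦ card_image_le)))
  calc _ ≤ ∑ Q ∈ S, ∑ x ∈ partSlice i Q.1, (#{y ∈ partSlice j Q.2 | r x y} : ℝ) := by
        exact_mod_cast h1
    _ ≤ ∑ Q ∈ S, γ * (#(partSlice i Q.1) * #(partSlice j Q.2)) :=
        sum_le_sum fun Q hQ ↦ (mem_filter.1 hQ).2.le
    _ ≤ ∑ Q ∈ P.parts ×ˢ P.parts, γ * (#(partSlice i Q.1) * #(partSlice j Q.2)) :=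
        sum_le_sum_of_subset_of_nonneg (filter_subset _ _) fun _ _ _ ↦ by positivity
    _ = γ * ((∑ A ∈ P.parts, #(partSlice i A) : ℕ) * (∑ A ∈ P.parts, #(partSlice j A) : ℕ)) := by
        rw [← mul_sum, sum_product]
        push_cast
        rw [sum_mul_sum]
    _ = _ := by rw [sum_card_partSlice, sum_card_partSlice, sq]

lemma card_pairs_of_mem_le (i j : Fin h) (S : Finset ((Fin h × V) × (Fin h × V))) :
    #{p : V × V | ((i, p.1), (j, p.2)) ∈ S} ≤ #S := by
  refine card_le_card_of_injOn (fun p ↦ ((i, p.1), (j, p.2))) (fun p hp ↦ ?_) ?_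
  · simpa using hp
  · rintro ⟨x, y⟩ - ⟨x', y'⟩ - hp
    simpa using hp

end PartiteGraph

section Removal

open Finset Classical

/-- Regularity step of the removal lemma: after deleting few pairs, every remaining pair lies in
lower regular slices of a partition of `Fin h × V` with a bounded number of parts. -/
lemma exists_cleaning_partition {h l : ℕ} (hh : 0 < h) {V : Type*} [Fintype V]
    (hl0 : 0 < l) (hl : l ≤ Fintype.card V) {ε β τ ε₁ : ℝ} (hε : 0 < ε) (hβ : 0 < β)
    (hετ : ε ≤ τ) (hε₁ : 0 < ε₁) (hlε : 4 / ε₁ ≤ l) (R : Fin h → Fin h → V → V → Prop) :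
    ∃ (P : Finpartition (univ : Finset (Fin h × V))) (E : Fin h → Fin h → Finset (V × V)),
      P.IsEquipartition ∧ #P.parts ≤ SzemerediRegularity.bound ε l ∧
      (∀ i j, (#(E i j) : ℝ) ≤ (ε₁ / 2 * h ^ 2 + 4 * ε * h ^ 2 + 2 * τ * h + (β + 2 * ε)) *
        (Fintype.card V : ℝ) ^ 2) ∧
      ∀ i j, i < j → ∀ x y, R i j x y → (x, y) ∉ E i j →
        τ * #(P.part (i, x)) ≤ #(partSlice i (P.part (i, x))) ∧
        τ * #(P.part (j, y)) ≤ #(partSlice j (P.part (j, y))) ∧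
        ∀ c : ℝ, 0 < c → (∀ A ∈ P.parts, #A * ε ≤ c) →
          LowerRegular (R i j) β c (partSlice i (P.part (i, x))) (partSlice j (P.part (j, y))) := by
  have hcard : Fintype.card (Fin h × V) = h * Fintype.card V := by simp
  obtain ⟨P, hPe, hPl, hPb, hPu⟩ := szemeredi_regularity (partiteGraph R) hε (l := l)
    (by rw [hcard]; exact hl.trans (Nat.le_mul_of_pos_left _ hh))
  set n : ℝ := (Fintype.card V : ℝ) with hn
  have hN : ((#(univ : Finset (Fin h × V)) : ℕ) : ℝ) = h * n := by simp [hn]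
  let inner : Finset ((Fin h × V) × (Fin h × V)) := P.parts.biUnion offDiag
  let irreg : Finset ((Fin h × V) × (Fin h × V)) :=
    (P.nonUniforms (partiteGraph R) ε).biUnion fun Q ↦ Q.1 ×ˢ Q.2
  let small (i : Fin h) : Finset V :=
    {x | (#(partSlice i (P.part (i, x))) : ℝ) < τ * #(P.part (i, x))}
  let sparse (i j : Fin h) : Finset (V × V) := {p | R i j p.1 p.2 ∧
      ∑ x ∈ partSlice i (P.part (i, p.1)), (#{y ∈ partSlice j (P.part (j, p.2)) | R i j x y} : ℝ) <
        (β + 2 * ε) * (#(partSlice i (P.part (i, p.1))) * #(partSlice j (P.part (j, p.2))))}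
  let E (i j : Fin h) : Finset (V × V) :=
    univ.filter (fun p ↦ ((i, p.1), (j, p.2)) ∈ inner) ∪
      univ.filter (fun p ↦ ((i, p.1), (j, p.2)) ∈ irreg) ∪
      (small i ×ˢ univ ∪ univ ×ˢ small j) ∪ sparse i j
  have hinner : (#inner : ℝ) ≤ ε₁ / 2 * h ^ 2 * n ^ 2 := by
    have := hPe.card_biUnion_offDiag_le hε₁ (hlε.trans (by exact_mod_cast hPl))
    rw [hN] at this
    linarith
  have hirreg : (#irreg : ℝ) ≤ 4 * ε * h ^ 2 * n ^ 2 := by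
    have hne : (univ : Finset (Fin h × V)).Nonempty := by
      rw [← card_pos, card_univ, hcard]
      exact Nat.mul_pos hh (hl0.trans_le hl)
    have := hPe.sum_nonUniforms_lt hne hε hPu
    rw [hN] at this
    linarith
  have hsmall (i : Fin h) : (#(small i) : ℝ) ≤ τ * (h * n) :=
    card_small_partSlice_le P i (hε.le.trans hετ)
  have hsparse (i j : Fin h) : (#(sparse i j) : ℝ) ≤ (β + 2 * ε) * n ^ 2 :=
    card_sparse_partSlice_le P (R i j) i j (by positivity)
  refine ⟨P, E, hPe, hPb, fun i j ↦ ?_, fun i j hij x y hR hxy ↦ ?_⟩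
  · have h1 : #(E i j) ≤ #inner + #irreg + (#(small i) * Fintype.card V +
        Fintype.card V * #(small j)) + #(sparse i j) := by
      refine (card_union_le _ _).trans (Nat.add_le_add_right ?_ _)
      refine (card_union_le _ _).trans (Nat.add_le_add ?_ ?_)
      · exact (card_union_le _ _).trans (Nat.add_le_add (card_pairs_of_mem_le _ _ _)
          (card_pairs_of_mem_le _ _ _))
      · refine (card_union_le _ _).trans ?_
        simp [card_product]
    have h2 : (#(E i j) : ℝ) ≤ #inner + #irreg + (#(small i) * n + n * #(small j)) +
        #(sparse i j) := by
      rw [hn]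
      exact_mod_cast h1
    have hn0 : 0 ≤ n := Nat.cast_nonneg _
    have h3 := mul_le_mul_of_nonneg_right (hsmall i) hn0
    have h4 := mul_le_mul_of_nonneg_right (hsmall j) hn0
    have h5 := hsparse i j
    nlinarith
  · simp only [E, mem_union, not_or] at hxy
    obtain ⟨⟨⟨hin, hir⟩, hsi, hsj⟩, hsp⟩ := hxy
    have hxP := P.mem_part (mem_univ (i, x))
    have hyP := P.mem_part (mem_univ (j, y))
    have hAP : P.part (i, x) ∈ P.parts := P.part_mem.2 (mem_univ _)
    have hBP : P.part (j, y) ∈ P.parts := P.part_mem.2 (mem_univ _)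
    simp only [small, mem_product, mem_filter, mem_univ, true_and, and_true, not_lt] at hsi hsj
    simp only [sparse, mem_filter, mem_univ, true_and, hR, not_lt] at hsp
    have hne : P.part (i, x) ≠ P.part (j, y) := by
      intro heq
      rw [← heq] at hyP
      refine hin (mem_filter.2 ⟨mem_univ _, mem_biUnion.2 ⟨_, hAP, mem_offDiag.2
        ⟨hxP, hyP, fun h' ↦ hij.ne (congrArg Prod.fst h')⟩⟩⟩)
    have hu : (partiteGraph R).IsUniform ε (P.part (i, x)) (P.part (j, y)) := by
      by_contra hnu
      exact hir (mem_filter.2 ⟨mem_univ _, mem_biUnion.2 ⟨(_, _),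
        (P.mk_mem_nonUniforms (partiteGraph R)).2 ⟨hAP, hBP, hne, hnu⟩,
        mem_product.2 ⟨hxP, hyP⟩⟩⟩)
    refine ⟨hsi, hsj, fun c hc hcA ↦ hu.lowerRegular hij hc ?_ ?_ (hcA _ hAP) (hcA _ hBP) hsp⟩
    · refine le_trans ?_ hsi
      rw [mul_comm]
      gcongr
    · refine le_trans ?_ hsj
      rw [mul_comm]
      gcongr

/-- Constants for the removal lemma: `β` is the density, `τ` the relative slice size, `ε` the
regularity parameter and `1 / ε₁` controls the number of parts. -/
lemma exists_removal_constants {h : ℕ} (hh : 0 < h) {e : ℝ} (he : 0 < e) :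
    ∃ β τ ε ε₁ : ℝ, 0 < β ∧ β ≤ 1 ∧ 0 < τ ∧ τ * h ≤ 1 ∧ 0 < ε ∧ ε ≤ τ ∧ 0 < ε₁ ∧
      4 * (h + 1) * ε ≤ τ * β ^ h ∧
      ε₁ / 2 * h ^ 2 + 4 * ε * h ^ 2 + 2 * τ * h + (β + 2 * ε) ≤ e := by
  have hh1 : (1 : ℝ) ≤ h := by exact_mod_cast hh
  obtain ⟨a, ha0, ha1, hae⟩ : ∃ a : ℝ, 0 < a ∧ a ≤ 1 ∧ a ≤ e :=
    ⟨min e 1, lt_min he one_pos, min_le_right _ _, min_le_left _ _⟩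
  obtain ⟨β, hβ⟩ : ∃ β : ℝ, β = a / 16 := ⟨_, rfl⟩
  obtain ⟨τ, hτ⟩ : ∃ τ : ℝ, τ = a / (16 * h) := ⟨_, rfl⟩
  obtain ⟨ε₁, hε₁⟩ : ∃ ε₁ : ℝ, ε₁ = a / (4 * h ^ 2) := ⟨_, rfl⟩
  have hβ0 : 0 < β := by rw [hβ]; positivity
  have hβ1 : β ≤ 1 := by linarith
  have hτ0 : 0 < τ := by rw [hτ]; positivity
  have hτh : τ * h = a / 16 := by rw [hτ]; field_simp
  have hε₁0 : 0 < ε₁ := by rw [hε₁]; positivity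
  have hε₁h : ε₁ * h ^ 2 = a / 4 := by rw [hε₁]; field_simp
  obtain ⟨ε, hε0, hε1, hετβ⟩ : ∃ ε : ℝ, 0 < ε ∧ ε ≤ a / (32 * h ^ 2) ∧
      ε ≤ τ * β ^ h / (4 * (h + 1)) :=
    ⟨min (a / (32 * h ^ 2)) (τ * β ^ h / (4 * (h + 1))), lt_min (by positivity) (by positivity),
      min_le_left _ _, min_le_right _ _⟩
  rw [le_div_iff₀ (by positivity)] at hε1 hετβ
  have hεh : ε * h ^ 2 ≤ a / 32 := by linarith
  have hεa : ε ≤ a / 32 := (le_mul_of_one_le_right hε0.le (one_le_pow₀ hh1)).trans hεh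
  have hετ : ε ≤ τ := by
    have h1 : τ * β ^ h ≤ τ := mul_le_of_le_one_right hτ0.le (pow_le_one₀ hβ0.le hβ1)
    have h2 : ε ≤ ε * (4 * (h + 1)) := le_mul_of_one_le_right hε0.le (by linarith)
    linarith
  exact ⟨β, τ, ε, ε₁, hβ0, hβ1, hτ0, by linarith, hε0, hετ, hε₁0, by linarith, by linarith⟩

/-- The partite removal lemma for homomorphisms: `D i j` for `i < j` records which pairs of
vertices are constrained. -/
theorem partite_removal (h : ℕ) (D : Fin h → Fin h → Prop) {e : ℝ} (he : 0 < e) :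
    ∃ δ : ℝ, 0 < δ ∧ ∀ (V : Type) [Fintype V] (R : Fin h → Fin h → V → V → Prop),
      (Nat.card {f : Fin h → V // ∀ i j, i < j → D i j → R i j (f i) (f j)} : ℝ) ≤
        δ * (Fintype.card V : ℝ) ^ h →
      ∃ E : Fin h → Fin h → Finset (V × V),
        (∀ i j, (#(E i j) : ℝ) ≤ e * (Fintype.card V : ℝ) ^ 2) ∧
        ∀ f : Fin h → V, ∃ i j, i < j ∧ D i j ∧ (R i j (f i) (f j) → (f i, f j) ∈ E i j) := by
  rcases Nat.eq_zero_or_pos h with rfl | hh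
  · refine ⟨1 / 2, by norm_num, fun V _ R hcard ↦ ?_⟩
    norm_num at hcard
  obtain ⟨β, τ, ε, ε₁, hβ0, hβ1, hτ0, hτh, hε0, hετ, hε₁0, hετβ, hsum⟩ :=
    exists_removal_constants hh he
  set l : ℕ := ⌈4 / ε₁⌉₊ with hl
  have hl0 : 0 < l := Nat.ceil_pos.2 (by positivity)
  set M : ℕ := SzemerediRegularity.bound ε l with hM
  have hM0 : 0 < M := SzemerediRegularity.bound_pos _ _
  set κ : ℝ := (2 * ε * h / M) ^ h with hκ
  have hκ0 : 0 < κ := by positivity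
  refine ⟨min (κ / 2) (1 / (2 * l ^ h)), lt_min (by positivity) (by positivity),
    fun V _ R hcard ↦ ?_⟩
  set n : ℝ := (Fintype.card V : ℝ) with hn
  rcases lt_or_ge (Fintype.card V) l with hnl | hnl
  · refine ⟨fun _ _ ↦ ∅, fun i j ↦ by simp; positivity, fun f ↦ ?_⟩
    by_contra! hf
    have h1 : 1 ≤ Nat.card {f : Fin h → V // ∀ i j, i < j → D i j → R i j (f i) (f j)} :=
      Nat.card_pos_iff.2 ⟨⟨⟨f, fun i j hij hD ↦ (hf i j hij hD).1⟩⟩, inferInstance⟩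
    have h2 : min (κ / 2) (1 / (2 * l ^ h)) * n ^ h ≤ 1 / (2 * l ^ h) * (l : ℝ) ^ h := by
      have : n ≤ l := by rw [hn]; exact_mod_cast hnl.le
      gcongr
      exact min_le_right _ _
    have h3 : 1 / (2 * l ^ h) * (l : ℝ) ^ h = 1 / 2 := by field_simp
    have h4 : (1 : ℝ) ≤
      Nat.card {f : Fin h → V // ∀ i j, i < j → D i j → R i j (f i) (f j)} := by exact_mod_cast h1
    linarith
  have hn0 : 0 < n := by rw [hn]; exact_mod_cast hl0.trans_le hnl
  obtain ⟨P, E, hPe, hPb, hE, hclean⟩ := exists_cleaning_partition hh hl0 hnl hε0 hβ0 hετ hε₁0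
    (Nat.le_ceil _) R
  refine ⟨E, fun i j ↦ (hE i j).trans ?_, fun f ↦ ?_⟩
  · gcongr
  by_contra! hf
  set K : ℝ := (#P.parts : ℝ) with hK
  obtain ⟨i₀⟩ : Nonempty (Fin h) := ⟨⟨0, hh⟩⟩
  have hK0 : 0 < K := by
    rw [hK]
    exact_mod_cast card_pos.2 ⟨_, P.part_mem.2 (mem_univ (i₀, f i₀))⟩
  have hK1 : 1 ≤ K := by
    rw [hK] at hK0 ⊢
    exact_mod_cast hK0
  have hKM : K ≤ M := by rw [hK]; exact_mod_cast hPb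
  have hpart (A : Finset (Fin h × V)) (hA : A ∈ P.parts) :
      h * n ≤ 2 * K * #A ∧ K * #A ≤ 2 * (h * n) := by
    have := hPe.card_part_bounds hA
    rw [card_univ, Fintype.card_prod, Fintype.card_fin] at this
    exact ⟨by rw [hn, hK]; exact_mod_cast this.1, by rw [hn, hK]; exact_mod_cast this.2⟩
  set c : ℝ := 2 * ε * h / K * n with hc
  have hc0 : 0 < c := by positivity
  have hcA (A : Finset (Fin h × V)) (hA : A ∈ P.parts) : #A * ε ≤ c := by
    have := (hpart A hA).2
    rw [hc, div_mul_eq_mul_div, le_div_iff₀ hK0]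
    linarith [mul_le_mul_of_nonneg_right this hε0.le]
  let W (i : Fin h) : Finset V :=
    if ∃ j, (i < j ∧ D i j) ∨ (j < i ∧ D j i) then partSlice i (P.part (i, f i)) else univ
  have hWsize (i : Fin h) : ((h : ℕ) + 1) * c / β ^ h ≤ #(W i) := by
    have h1 : (h + 1) * c / β ^ h ≤ τ * (h * n) / (2 * K) := by
      rw [hc, div_le_div_iff₀ (by positivity) (by positivity)]
      have : (h + 1) * (2 * ε * h / K * n) * (2 * K) = 4 * (h + 1) * ε * (h * n) := by
        field_simp
        ring
      rw [this]
      have := mul_le_mul_of_nonneg_right hετβ (by positivity : 0 ≤ h * n)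
      linarith
    refine h1.trans ?_
    rw [div_le_iff₀ (by positivity)]
    by_cases hi : ∃ j, (i < j ∧ D i j) ∨ (j < i ∧ D j i)
    · have h2 : τ * #(P.part (i, f i)) ≤ #(W i) := by
        simp only [W, if_pos hi]
        obtain ⟨j, ⟨hij, hD⟩ | ⟨hij, hD⟩⟩ := hi
        · exact (hclean i j hij _ _ (hf i j hij hD).1 (hf i j hij hD).2).1
        · exact (hclean j i hij _ _ (hf j i hij hD).1 (hf j i hij hD).2).2.1
      have h3 := (hpart _ (P.part_mem.2 (mem_univ (i, f i)))).1
      calc τ * (h * n) ≤ τ * (2 * K * #(P.part (i, f i))) := by gcongr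
        _ = τ * #(P.part (i, f i)) * (2 * K) := by ring
        _ ≤ #(W i) * (2 * K) := by gcongr
    · simp only [W, if_neg hi, card_univ]
      rw [← hn]
      have h2 : τ * h ≤ 2 * K := by linarith
      linarith [mul_le_mul_of_nonneg_right h2 hn0.le]
  have hWreg (i j : Fin h) (hij : i < j) :
      LowerRegular (fun x y ↦ D i j → R i j x y) β c (W i) (W j) := by
    by_cases hD : D i j
    · simp only [W, if_pos (⟨j, Or.inl ⟨hij, hD⟩⟩ : ∃ j, (i < j ∧ D i j) ∨ (j < i ∧ D j i)),
        if_pos (⟨i, Or.inr ⟨hij, hD⟩⟩ : ∃ i, (j < i ∧ D j i) ∨ (i < j ∧ D i j)),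
        hD, forall_const]
      exact (hclean i j hij _ _ (hf i j hij hD).1 (hf i j hij hD).2).2.2 c hc0 hcA
    · intro X _ Y _ _ _
      simp only [hD, false_imp_iff, filter_true, sum_const, nsmul_eq_mul]
      exact mul_le_of_le_one_left (by positivity) hβ1
  have hcount := pow_le_card_transversals hβ0 hβ1 hc0 h h le_rfl
    (fun i j x y ↦ D i j → R i j x y) W hWreg hWsize
  have hle : Nat.card {f : Fin h → V // (∀ i, f i ∈ W i) ∧
      ∀ i j, i < j → D i j → R i j (f i) (f j)} ≤
      Nat.card {f : Fin h → V // ∀ i j, i < j → D i j → R i j (f i) (f j)} :=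
    Nat.card_le_card_of_injective (fun g ↦ ⟨g.1, g.2.2⟩) fun g g' hg ↦
      Subtype.ext (Subtype.mk.inj hg)
  have hle' : (Nat.card {f : Fin h → V // (∀ i, f i ∈ W i) ∧
      ∀ i j, i < j → D i j → R i j (f i) (f j)} : ℝ) ≤
      Nat.card {f : Fin h → V // ∀ i j, i < j → D i j → R i j (f i) (f j)} := by
    exact_mod_cast hle
  have hlow : κ * n ^ h ≤ c ^ h := by
    rw [hκ, hc, ← mul_pow]
    gcongr
  have hup : min (κ / 2) (1 / (2 * l ^ h)) * n ^ h ≤ κ / 2 * n ^ h := by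
    gcongr
    exact min_le_left _ _
  have hpos : 0 < κ * n ^ h := by positivity
  linarith

lemma card_map_eq_le {h : ℕ} {V : Type*} [Fintype V] {i j : Fin h} (hij : i ≠ j) :
    #{f : Fin h → V | f i = f j} ≤ Fintype.card V ^ (h - 1) := by
  have : Fintype.card ({k : Fin h // k ≠ i} → V) = Fintype.card V ^ (h - 1) := by
    simp
  rw [← this, ← card_univ]
  refine card_le_card_of_injOn (fun f k ↦ f k.1) (fun _ _ ↦ mem_coe.2 (mem_univ _)) ?_
  intro f hf g hg hfg
  simp only [coe_filter, mem_univ, true_and, Set.mem_ofPred_eq] at hf hg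
  have key (k : Fin h) (hk : k ≠ i) : f k = g k := congrFun hfg ⟨k, hk⟩
  funext k
  by_cases hk : k = i
  · rw [hk, hf, hg]
    exact key j hij.symm
  · exact key k hk

lemma card_not_injective_le (h : ℕ) (V : Type*) [Fintype V] :
    #{f : Fin h → V | ¬ Function.Injective f} ≤ h ^ 2 * Fintype.card V ^ (h - 1) := by
  have hsub : ({f : Fin h → V | ¬ Function.Injective f} : Finset (Fin h → V)) ⊆
      (univ : Finset (Fin h)).offDiag.biUnion fun p ↦ {f | f p.1 = f p.2} := by
    intro f hf
    have := (mem_filter.1 hf).2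
    simp only [Function.Injective, not_forall] at this
    obtain ⟨i, j, hfij, hij⟩ := this
    exact mem_biUnion.2 ⟨(i, j), by simpa using hij, by simpa using hfij⟩
  calc _ ≤ ∑ p ∈ (univ : Finset (Fin h)).offDiag, #{f : Fin h → V | f p.1 = f p.2} :=
        (card_le_card hsub).trans card_biUnion_le
    _ ≤ ∑ p ∈ (univ : Finset (Fin h)).offDiag, Fintype.card V ^ (h - 1) :=
        sum_le_sum fun p hp ↦ card_map_eq_le (mem_offDiag.1 hp).2.2
    _ ≤ h ^ 2 * Fintype.card V ^ (h - 1) := by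
        rw [sum_const, smul_eq_mul, offDiag_card, card_univ, Fintype.card_fin, sq]
        exact Nat.mul_le_mul_right _ (Nat.sub_le _ _)

/-- The partite removal lemma, assuming few *injective* homomorphisms. -/
theorem partite_removal_of_injective (h : ℕ) (D : Fin h → Fin h → Prop) {e : ℝ} (he : 0 < e) :
    ∃ δ : ℝ, 0 < δ ∧ ∀ (V : Type) [Fintype V] (R : Fin h → Fin h → V → V → Prop),
      (Nat.card {f : Fin h → V // Function.Injective f ∧
        ∀ i j, i < j → D i j → R i j (f i) (f j)} : ℝ) ≤ δ * (Fintype.card V : ℝ) ^ h →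
      ∃ E : Fin h → Fin h → Finset (V × V),
        (∀ i j, (#(E i j) : ℝ) ≤ e * (Fintype.card V : ℝ) ^ 2) ∧
        ∀ f : Fin h → V, Function.Injective f →
          ∃ i j, i < j ∧ D i j ∧ (R i j (f i) (f j) → (f i, f j) ∈ E i j) := by
  obtain ⟨δ, hδ, hrem⟩ := partite_removal h D he
  obtain ⟨n₀, hn₀⟩ := exists_nat_ge (2 * h ^ 2 / δ + 1)
  have hn₀1 : (1 : ℝ) ≤ n₀ := le_trans (by linarith [show 0 ≤ 2 * h ^ 2 / δ by positivity]) hn₀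
  have hn₀0 : (0 : ℝ) < n₀ := by linarith
  refine ⟨min (δ / 2) (1 / (2 * n₀ ^ h)), lt_min (by positivity) (by positivity),
    fun V _ R hcard ↦ ?_⟩
  set n : ℝ := (Fintype.card V : ℝ) with hn
  have hn0 : 0 ≤ n := Nat.cast_nonneg _
  rcases lt_or_ge n n₀ with hlt | hge
  · refine ⟨fun _ _ ↦ ∅, fun i j ↦ by simp; positivity, fun f hinj ↦ ?_⟩
    by_contra! hf
    have h1 : 1 ≤ Nat.card {f : Fin h → V // Function.Injective f ∧
        ∀ i j, i < j → D i j → R i j (f i) (f j)} :=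
      Nat.card_pos_iff.2 ⟨⟨⟨f, hinj, fun i j hij hD ↦ (hf i j hij hD).1⟩⟩, inferInstance⟩
    have h2 : min (δ / 2) (1 / (2 * n₀ ^ h)) * n ^ h ≤ 1 / (2 * n₀ ^ h) * (n₀ : ℝ) ^ h := by
      gcongr
      exact min_le_right _ _
    have h3 : 1 / (2 * n₀ ^ h) * (n₀ : ℝ) ^ h = 1 / 2 := by field_simp
    have h4 : (1 : ℝ) ≤ Nat.card {f : Fin h → V // Function.Injective f ∧
        ∀ i j, i < j → D i j → R i j (f i) (f j)} := by exact_mod_cast h1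
    linarith
  · have h1 : Nat.card {f : Fin h → V // ∀ i j, i < j → D i j → R i j (f i) (f j)} ≤
        Nat.card {f : Fin h → V // Function.Injective f ∧
          ∀ i j, i < j → D i j → R i j (f i) (f j)} + h ^ 2 * Fintype.card V ^ (h - 1) := by
      refine le_trans ?_ (Nat.add_le_add_left (card_not_injective_le h V) _)
      simp only [Nat.card_eq_fintype_card, Fintype.card_subtype]
      refine le_trans (card_le_card fun f hf ↦ ?_) (card_union_le _ _)
      by_cases hinj : Function.Injective f <;> simp_all
    have h2 : (h : ℝ) ^ 2 * n ^ (h - 1) ≤ δ / 2 * n ^ h := by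
      rcases Nat.eq_zero_or_pos h with rfl | hh
      · simp; positivity
      · have h3 : 2 * h ^ 2 / δ ≤ n := by linarith
        rw [div_le_iff₀ hδ] at h3
        have h4 : n ^ h = n ^ (h - 1) * n := by rw [← pow_succ, Nat.sub_add_cancel hh]
        rw [h4]
        have h5 : 0 ≤ n ^ (h - 1) := by positivity
        nlinarith
    have h3 : min (δ / 2) (1 / (2 * n₀ ^ h)) * n ^ h ≤ δ / 2 * n ^ h := by
      gcongr
      exact min_le_left _ _
    have h4 : (Nat.card {f : Fin h → V // ∀ i j, i < j → D i j → R i j (f i) (f j)} : ℝ) ≤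
        Nat.card {f : Fin h → V // Function.Injective f ∧
          ∀ i j, i < j → D i j → R i j (f i) (f j)} + h ^ 2 * n ^ (h - 1) := by
      rw [hn]
      exact_mod_cast h1
    obtain ⟨E, hE, hf⟩ := hrem V R (by rw [← hn]; linarith)
    exact ⟨E, hE, fun f _ ↦ hf f⟩

end Removal

/-- **Removal Lemma for arc-colored directed graphs**.
Digraphs are modelled as irreflexive relations, and an arc-coloring with colors
`{1, …, m}` (here `Fin m`) assigns a color to each arc (colors of non-arcs are
irrelevant).  A color-preserving copy of `H` in `G` is an injective map on
vertices sending every arc of `H` to an arc of `G` of the same color.  If an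
arc-colored digraph `G` on `n` vertices contains at most `δ·n^h` color-preserving
copies of a fixed arc-colored digraph `H` on `h` vertices, then at most `ε·n²`
arcs can be removed from `G` so that no color-preserving copy of `H` remains. -/
theorem removal_lemma_colored_digraphs
    (m : ℕ) (VH : Type) [Fintype VH] (H : VH → VH → Prop) (hH : ∀ v, ¬ H v v)
    (cH : VH → VH → Fin m) :
    ∀ ε : ℝ, 0 < ε → ∃ δ : ℝ, 0 < δ ∧
      ∀ (VG : Type) [Fintype VG] (Gr : VG → VG → Prop), (∀ v, ¬ Gr v v) →
        ∀ cG : VG → VG → Fin m,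
        ((Nat.card {f : VH → VG // Function.Injective f ∧
              ∀ u v, H u v → (Gr (f u) (f v) ∧ cG (f u) (f v) = cH u v)} : ℝ)
            ≤ δ * (Fintype.card VG : ℝ) ^ (Fintype.card VH)) →
        ∃ E : Set (VG × VG),
          (∀ p ∈ E, Gr p.1 p.2) ∧
          ((E.ncard : ℝ) ≤ ε * (Fintype.card VG : ℝ) ^ 2) ∧
          ¬ ∃ f : VH → VG, Function.Injective f ∧
              ∀ u v, H u v →
                (Gr (f u) (f v) ∧ cG (f u) (f v) = cH u v ∧ (f u, f v) ∉ E) := by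
  classical
  intro ε hε
  set h := Fintype.card VH with hh
  let φ : VH ≃ Fin h := Fintype.equivFin VH
  obtain ⟨δ, hδ, hrem⟩ := partite_removal_of_injective h
    (fun i j ↦ H (φ.symm i) (φ.symm j) ∨ H (φ.symm j) (φ.symm i))
    (e := ε / (2 * (h ^ 2 + 1))) (by positivity)
  refine ⟨δ, hδ, fun VG _ Gr _ cG hcard ↦ ?_⟩
  let Q (u v : VH) (x y : VG) : Prop := H u v → (Gr x y ∧ cG x y = cH u v)
  let R (i j : Fin h) (x y : VG) : Prop :=
    Q (φ.symm i) (φ.symm j) x y ∧ Q (φ.symm j) (φ.symm i) y x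
  obtain ⟨E, hE, hfree⟩ := hrem VG R (by
    refine le_trans ?_ hcard
    have : Nat.card {f : Fin h → VG // Function.Injective f ∧ ∀ i j, i < j →
        (H (φ.symm i) (φ.symm j) ∨ H (φ.symm j) (φ.symm i)) → R i j (f i) (f j)} ≤
        Nat.card {f : VH → VG // Function.Injective f ∧
          ∀ u v, H u v → (Gr (f u) (f v) ∧ cG (f u) (f v) = cH u v)} := by
      refine Nat.card_le_card_of_injective
        (fun f ↦ ⟨f.1 ∘ φ, f.2.1.comp φ.injective, fun u v huv ↦ ?_⟩) fun f g hfg ↦ ?_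
      · rcases lt_trichotomy (φ u) (φ v) with hlt | heq | hlt
        · have := (f.2.2 _ _ hlt (by simp [huv])).1
          simp only [Q, φ.symm_apply_apply] at this
          exact this huv
        · exact absurd huv (φ.injective heq ▸ hH u)
        · have := (f.2.2 _ _ hlt (by simp [huv])).2
          simp only [Q, φ.symm_apply_apply] at this
          exact this huv
      · exact Subtype.ext (φ.surjective.injective_comp_right (congrArg Subtype.val hfg))
    exact_mod_cast this)
  let F : Finset (VG × VG) := Finset.univ.biUnion fun p : Fin h × Fin h ↦
    E p.1 p.2 ∪ (E p.1 p.2).image Prod.swap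
  refine ⟨{p | Gr p.1 p.2 ∧ p ∈ F}, fun p hp ↦ hp.1, ?_, ?_⟩
  · have h1 : ({p | Gr p.1 p.2 ∧ p ∈ F} : Set (VG × VG)).ncard ≤ F.card := by
      rw [← Set.ncard_coe_finset]
      exact Set.ncard_le_ncard (fun p hp ↦ hp.2) F.finite_toSet
    have h2 : F.card ≤ ∑ p : Fin h × Fin h, 2 * (E p.1 p.2).card := by
      refine Finset.card_biUnion_le.trans (Finset.sum_le_sum fun p _ ↦ ?_)
      refine (Finset.card_union_le _ _).trans ?_
      rw [two_mul]
      exact Nat.add_le_add_left Finset.card_image_le _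
    set n : ℝ := (Fintype.card VG : ℝ) with hn
    have h3 : (∑ p : Fin h × Fin h, 2 * ((E p.1 p.2).card : ℝ)) ≤
        ∑ p : Fin h × Fin h, 2 * (ε / (2 * (h ^ 2 + 1)) * n ^ 2) :=
      Finset.sum_le_sum fun p _ ↦ by linarith [hE p.1 p.2]
    calc (({p | Gr p.1 p.2 ∧ p ∈ F} : Set (VG × VG)).ncard : ℝ)
        ≤ ∑ p : Fin h × Fin h, 2 * ((E p.1 p.2).card : ℝ) := by exact_mod_cast h1.trans h2
      _ ≤ _ := h3
      _ = (h ^ 2 / (h ^ 2 + 1)) * (ε * n ^ 2) := by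
        simp only [Finset.sum_const, Finset.card_univ, Fintype.card_prod, Fintype.card_fin,
          nsmul_eq_mul, Nat.cast_mul]
        field_simp
      _ ≤ ε * n ^ 2 := by
        refine mul_le_of_le_one_left (by positivity) ?_
        rw [div_le_one (by positivity)]
        linarith
  · rintro ⟨f, hinj, hf⟩
    obtain ⟨i, j, hij, hD, hR⟩ := hfree (f ∘ φ.symm) (hinj.comp φ.symm.injective)
    have hmem := hR ⟨fun h' ↦ ⟨(hf _ _ h').1, (hf _ _ h').2.1⟩,
      fun h' ↦ ⟨(hf _ _ h').1, (hf _ _ h').2.1⟩⟩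
    rcases hD with hD | hD
    · refine (hf _ _ hD).2.2 ⟨(hf _ _ hD).1, Finset.mem_biUnion.2 ⟨(i, j), Finset.mem_univ _, ?_⟩⟩
      exact Finset.mem_union_left _ hmem
    · refine (hf _ _ hD).2.2 ⟨(hf _ _ hD).1, Finset.mem_biUnion.2 ⟨(i, j), Finset.mem_univ _, ?_⟩⟩
      exact Finset.mem_union_right _ (Finset.mem_image.2 ⟨_, hmem, rfl⟩)
end

section
/- For every ε > 0 there exists δ > 0 such that the following holds. Let G be a finite group of order N and let A, B, C, D, E be subsets of G. If ∑_{g ∈ E} r_{A,B}(g)·r_{C,D}(g) ≤ δ·N³, then there exist subsets A′ ⊆ A, B′ ⊆ B, C′ ⊆ C, D′ ⊆ D, E′ ⊆ E, each obtained by removing at most ε·N elements (i.e., |A \ A′| ≤ ε·N and similarly for the other four sets), such that ∑_{g ∈ E′} r_{A′,B′}(g)·r_{C′,D′}(g) = 0. -/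
/-- The representation function `r_{A,B}(g) = |{(a,b) ∈ A × B : ab = g}|`. -/
def repFn {G : Type*} [Mul G] [DecidableEq G] (A B : Finset G) (g : G) : ℕ :=
  ((A ×ˢ B).filter (fun p => p.1 * p.2 = g)).card

open Finset

/-- The directed relation underlying `SimpleGraph.cayleyTripartite`. -/
def cayleyTripartiteRel {G : Type*} [Group G] (A B E : Finset G) (p q : Fin 3 × G) : Prop :=
  p.1 = 0 ∧ q.1 = 1 ∧ p.2⁻¹ * q.2 ∈ A ∨ p.1 = 1 ∧ q.1 = 2 ∧ p.2⁻¹ * q.2 ∈ B ∨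
    p.1 = 0 ∧ q.1 = 2 ∧ p.2⁻¹ * q.2 ∈ E

/-- The tripartite graph on three copies of `G` whose triangles are the triples `x, y, z` with
`x⁻¹ * y ∈ A`, `y⁻¹ * z ∈ B` and `x⁻¹ * z ∈ E`. -/
def SimpleGraph.cayleyTripartite {G : Type*} [Group G] (A B E : Finset G) :
    SimpleGraph (Fin 3 × G) :=
  SimpleGraph.fromRel (cayleyTripartiteRel A B E)

theorem SimpleGraph.IsNClique.exists_of_cayleyTripartite {G : Type*} [Group G] [DecidableEq G]
    {A B E : Finset G} {t : Finset (Fin 3 × G)}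
    (ht : (SimpleGraph.cayleyTripartite A B E).IsNClique 3 t) :
    ∃ x y z, x⁻¹ * y ∈ A ∧ y⁻¹ * z ∈ B ∧ x⁻¹ * z ∈ E ∧ t = {(0, x), (1, y), (2, z)} := by
  obtain ⟨⟨i, x⟩, ⟨j, y⟩, ⟨k, z⟩, hxy, hxz, hyz, rfl⟩ := SimpleGraph.is3Clique_iff.1 ht
  simp only [SimpleGraph.cayleyTripartite, SimpleGraph.fromRel_adj, cayleyTripartiteRel]
    at hxy hxz hyz
  fin_cases i <;> fin_cases j <;> fin_cases k <;> simp at hxy hxz hyz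
  · exact ⟨x, y, z, hxy, hyz, hxz, rfl⟩
  · exact ⟨x, z, y, hxz, hyz, hxy, by ext; simp; tauto⟩
  · exact ⟨y, x, z, hxy, hxz, hyz, by ext; simp; tauto⟩
  · exact ⟨z, x, y, hxz, hxy, hyz, by ext; simp; tauto⟩
  · exact ⟨y, z, x, hyz, hxz, hxy, by ext; simp; tauto⟩
  · exact ⟨z, y, x, hyz, hxy, hxz, by ext; simp; tauto⟩

theorem sum_repFn {G : Type*} [Mul G] [DecidableEq G] (A B E : Finset G) :
    ∑ g ∈ E, repFn A B g = #{p ∈ A ×ˢ B | p.1 * p.2 ∈ E} := by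
  rw [card_eq_sum_card_fiberwise (f := fun p : G × G => p.1 * p.2) (t := E)
    (s := {p ∈ A ×ˢ B | p.1 * p.2 ∈ E}) (fun p hp => (mem_filter.1 hp).2)]
  refine sum_congr rfl fun g hg => ?_
  rw [repFn, filter_filter]
  congr 1
  refine filter_congr fun p _ => ⟨fun h => ⟨h ▸ hg, h⟩, fun h => h.2⟩

theorem SimpleGraph.card_cliqueFinset_cayleyTripartite_le {G : Type*} [Group G] [Fintype G]
    [DecidableEq G] (A B E : Finset G) [DecidableRel (SimpleGraph.cayleyTripartite A B E).Adj] :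
    #((SimpleGraph.cayleyTripartite A B E).cliqueFinset 3) ≤
      Fintype.card G * ∑ g ∈ E, repFn A B g := by
  rw [sum_repFn, ← card_univ (α := G), ← card_product]
  refine (card_le_card (t := image (fun q : G × G × G =>
    ({(0, q.1), (1, q.1 * q.2.1), (2, q.1 * (q.2.1 * q.2.2))} : Finset (Fin 3 × G))) _)
    fun t ht => ?_).trans card_image_le
  obtain ⟨x, y, z, hA, hB, hE, rfl⟩ :=
    (SimpleGraph.mem_cliqueFinset_iff.1 ht).exists_of_cayleyTripartite
  exact mem_image.2 ⟨(x, x⁻¹ * y, y⁻¹ * z), by simp [hA, hB, hE, mul_assoc], by simp⟩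

/-- The elements `a` such that at least a third of the values `f (x, a)` lie in `s`. -/
def heavyFibers {G α : Type*} [Fintype G] [DecidableEq α] (f : G × G → α) (s : Finset α)
    (A : Finset G) : Finset G :=
  {a ∈ A | Fintype.card G ≤ 3 * #{x : G | f (x, a) ∈ s}}

theorem card_mul_card_heavyFibers_le {G α : Type*} [Fintype G] [DecidableEq α]
    {f : G × G → α} (hf : f.Injective) (s : Finset α) (A : Finset G) :
    #(heavyFibers f s A) * Fintype.card G ≤ 3 * #s := by
  classical
  calc #(heavyFibers f s A) * Fintype.card G
      ≤ ∑ a ∈ heavyFibers f s A, 3 * #{x : G | f (x, a) ∈ s} := by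
        rw [← smul_eq_mul]
        exact card_nsmul_le_sum _ _ _ fun a ha => (mem_filter.1 ha).2
    _ ≤ ∑ a : G, 3 * #{x : G | f (x, a) ∈ s} :=
        sum_le_sum_of_subset (subset_univ _)
    _ = 3 * #{p : G × G | f p ∈ s} := by
        rw [← mul_sum]
        congr 1
        rw [card_eq_sum_card_fiberwise (f := Prod.snd) (t := univ) (fun _ _ => mem_univ _)]
        refine sum_congr rfl fun a _ => ?_
        refine card_bij (fun x _ => (x, a)) ?_ ?_ ?_ <;> aesop
    _ ≤ 3 * #s := by
        gcongr
        exact card_le_card_of_injOn f (fun p hp => (mem_filter.1 hp).2) hf.injOn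

theorem card_sdiff_sdiff_heavyFibers_le {G α : Type*} [Fintype G] [Nonempty G] [DecidableEq G]
    [DecidableEq α] {f : G × G → α} (hf : f.Injective) {s : Finset α} (A : Finset G) {ε : ℝ}
    (hs : (#s : ℝ) ≤ ε / 3 * Fintype.card G ^ 2) :
    (#(A \ (A \ heavyFibers f s A)) : ℝ) ≤ ε * Fintype.card G := by
  rw [Finset.sdiff_sdiff_eq_self (show heavyFibers f s A ⊆ A from filter_subset _ _)]
  have hN : (0 : ℝ) < Fintype.card G := by exact_mod_cast Fintype.card_pos
  have h : (#(heavyFibers f s A) * Fintype.card G : ℝ) ≤ 3 * #s := by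
    exact_mod_cast card_mul_card_heavyFibers_le hf s A
  refine le_of_mul_le_mul_right (h.trans ?_) hN
  linarith

/-- The edges of `SimpleGraph.cayleyTripartite` between the copies `i` and `j` of `G`, indexed by
starting point and label. -/
def cayleyEdge {G : Type*} [Mul G] (i j : Fin 3) (p : G × G) : Sym2 (Fin 3 × G) :=
  s((i, p.1), (j, p.1 * p.2))

theorem cayleyEdge_injective {G : Type*} [Group G] {i j : Fin 3} (hij : i ≠ j) :
    (cayleyEdge (G := G) i j).Injective := by
  rintro ⟨x, a⟩ ⟨y, b⟩ h
  simp only [cayleyEdge, Sym2.eq_iff, Prod.mk.injEq, true_and, hij, false_and, or_false] at h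
  obtain ⟨rfl, h⟩ := h
  simpa using h

/-- Removal lemma for the equation `a * b = g` in finite groups. -/
theorem exists_removal_of_sum_repFn_le {ε : ℝ} (hε : 0 < ε) :
    ∃ δ : ℝ, 0 < δ ∧ ∀ (G : Type) [Group G] [Fintype G] [DecidableEq G] (A B E : Finset G),
      ((∑ g ∈ E, repFn A B g : ℕ) : ℝ) ≤ δ * (Fintype.card G : ℝ) ^ 2 →
      ∃ A' ⊆ A, ∃ B' ⊆ B, ∃ E' ⊆ E,
        (#(A \ A') : ℝ) ≤ ε * Fintype.card G ∧ (#(B \ B') : ℝ) ≤ ε * Fintype.card G ∧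
        (#(E \ E') : ℝ) ≤ ε * Fintype.card G ∧
        ∀ a ∈ A', ∀ b ∈ B', a * b ∉ E' := by
  have hδ : 0 < SimpleGraph.triangleRemovalBound (ε / 27) :=
    SimpleGraph.triangleRemovalBound_pos (by positivity)
  refine ⟨_, hδ, fun G _ _ _ A B E h => ?_⟩
  classical
  have hN : (0 : ℝ) < Fintype.card G := by exact_mod_cast Fintype.card_pos
  have hfew : (#((SimpleGraph.cayleyTripartite A B E).cliqueFinset 3) : ℝ) <
      SimpleGraph.triangleRemovalBound (ε / 27) * Fintype.card (Fin 3 × G) ^ 3 := by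
    calc (#((SimpleGraph.cayleyTripartite A B E).cliqueFinset 3) : ℝ)
        ≤ Fintype.card G * (∑ g ∈ E, repFn A B g : ℕ) := by
          exact_mod_cast SimpleGraph.card_cliqueFinset_cayleyTripartite_le A B E
      _ ≤ Fintype.card G *
          (SimpleGraph.triangleRemovalBound (ε / 27) * (Fintype.card G : ℝ) ^ 2) := by gcongr
      _ < _ := by
          simp only [Fintype.card_prod, Fintype.card_fin, Nat.cast_mul, Nat.cast_ofNat]
          have : 0 < SimpleGraph.triangleRemovalBound (ε / 27) * (Fintype.card G : ℝ) ^ 3 := by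
            positivity
          nlinarith
  have hfar : ¬ (SimpleGraph.cayleyTripartite A B E).FarFromTriangleFree (ε / 27) :=
    fun hfar => hfew.not_ge hfar.le_card_cliqueFinset
  simp only [SimpleGraph.FarFromTriangleFree, SimpleGraph.DeleteFar, not_forall, not_le] at hfar
  obtain ⟨s, -, hfree, hs⟩ := hfar
  replace hs : (#s : ℝ) ≤ ε / 3 * Fintype.card G ^ 2 := by
    simp only [Fintype.card_prod, Fintype.card_fin] at hs
    push_cast at hs
    linarith
  refine ⟨A \ heavyFibers (cayleyEdge 0 1) s A, sdiff_subset,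
    B \ heavyFibers (cayleyEdge 1 2) s B, sdiff_subset,
    E \ heavyFibers (cayleyEdge 0 2) s E, sdiff_subset,
    card_sdiff_sdiff_heavyFibers_le (cayleyEdge_injective (by decide)) A hs,
    card_sdiff_sdiff_heavyFibers_le (cayleyEdge_injective (by decide)) B hs,
    card_sdiff_sdiff_heavyFibers_le (cayleyEdge_injective (by decide)) E hs, ?_⟩
  intro a ha b hb hab
  simp only [heavyFibers, mem_sdiff, mem_filter, not_and, not_le] at ha hb hab
  obtain ⟨haA, ha⟩ := ha
  obtain ⟨hbB, hb⟩ := hb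
  obtain ⟨habE, hab⟩ := hab
  specialize ha haA
  specialize hb hbB
  specialize hab habE
  have hshift : #{x : G | cayleyEdge 1 2 (x * a, b) ∈ s} = #{y : G | cayleyEdge 1 2 (y, b) ∈ s} :=
    card_equiv (Equiv.mulRight a) (by simp)
  obtain ⟨x, hx⟩ : ∃ x : G, x ∉ ({x : G | cayleyEdge 0 1 (x, a) ∈ s} : Finset G) ∪
      ({x : G | cayleyEdge 1 2 (x * a, b) ∈ s} : Finset G) ∪
      ({x : G | cayleyEdge 0 2 (x, a * b) ∈ s} : Finset G) := by
    by_contra! hall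
    have hle := card_le_card (fun x _ => hall x : (univ : Finset G) ⊆ _)
    have h₁ := hle.trans (card_union_le _ _)
    have h₂ := h₁.trans (Nat.add_le_add_right (card_union_le _ _) _)
    rw [card_univ] at h₂
    omega
  simp only [mem_union, mem_filter, mem_univ, true_and, not_or] at hx
  simp only [cayleyEdge, mul_assoc] at hx
  refine hfree {((0 : Fin 3), x), (1, x * a), (2, x * a * b)}
    (SimpleGraph.is3Clique_triple_iff.2 ⟨?_, ?_, ?_⟩)
  all_goals
    simp [SimpleGraph.cayleyTripartite, cayleyTripartiteRel, mul_assoc, haA, hbB, habE, hx]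

theorem card_mul_sq_le_sum_mul {ι : Type*} (E : Finset ι) (r r' : ι → ℕ) {c : ℝ} (hc : 0 ≤ c) :
    (#{g ∈ E | c < r g ∧ c < r' g} : ℝ) * c ^ 2 ≤ (∑ g ∈ E, r g * r' g : ℕ) := by
  push_cast
  calc (#{g ∈ E | c < r g ∧ c < r' g} : ℝ) * c ^ 2
      ≤ ∑ g ∈ E with c < r g ∧ c < r' g, (r g * r' g : ℝ) := by
        rw [← nsmul_eq_mul]
        refine card_nsmul_le_sum _ _ _ fun g hg => ?_
        obtain ⟨-, h, h'⟩ := mem_filter.1 hg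
        rw [sq]
        gcongr
    _ ≤ ∑ g ∈ E, (r g * r' g : ℝ) :=
        sum_le_sum_of_subset_of_nonneg (filter_subset _ _) fun _ _ _ => by positivity

theorem sum_filter_le_card_mul {G : Type*} [Fintype G] (E : Finset G) (r : G → ℕ) {η : ℝ}
    (hη : 0 ≤ η) :
    ((∑ g ∈ E with (r g : ℝ) ≤ η * Fintype.card G, r g : ℕ) : ℝ) ≤ η * Fintype.card G ^ 2 := by
  push_cast
  calc ∑ g ∈ E with (r g : ℝ) ≤ η * Fintype.card G, (r g : ℝ)
      ≤ #{g ∈ E | (r g : ℝ) ≤ η * Fintype.card G} • (η * Fintype.card G) :=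
        sum_le_card_nsmul _ _ _ fun g hg => (mem_filter.1 hg).2
    _ ≤ Fintype.card G * (η * Fintype.card G) := by
        rw [nsmul_eq_mul]
        gcongr
        exact card_le_univ _
    _ = η * Fintype.card G ^ 2 := by ring

theorem repFn_eq_zero {G : Type*} [Mul G] [DecidableEq G] {A B E : Finset G}
    (h : ∀ a ∈ A, ∀ b ∈ B, a * b ∉ E) {g : G} (hg : g ∈ E) : repFn A B g = 0 := by
  simp only [repFn, card_eq_zero, filter_eq_empty_iff, mem_product]
  rintro p ⟨ha, hb⟩ rfl
  exact h _ ha _ hb hg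

/-- For every `ε > 0` there is a `δ > 0` such that for every finite group `G` of
order `N` and subsets `A, B, C, D, E ⊆ G`: if `∑_{g ∈ E} r_{A,B}(g)·r_{C,D}(g) ≤ δ·N³`,
then removing at most `ε·N` elements from each set yields `A′, B′, C′, D′, E′` with
`∑_{g ∈ E′} r_{A′,B′}(g)·r_{C′,D′}(g) = 0`. -/
theorem removal_representation_functions :
    ∀ ε : ℝ, 0 < ε → ∃ δ : ℝ, 0 < δ ∧
      ∀ (G : Type) [Group G] [Fintype G] [DecidableEq G] (A B C D E : Finset G),
        (((∑ g ∈ E, repFn A B g * repFn C D g : ℕ) : ℝ)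
            ≤ δ * (Fintype.card G : ℝ) ^ 3) →
        ∃ A' B' C' D' E' : Finset G,
          A' ⊆ A ∧ B' ⊆ B ∧ C' ⊆ C ∧ D' ⊆ D ∧ E' ⊆ E ∧
          ((A \ A').card : ℝ) ≤ ε * (Fintype.card G : ℝ) ∧
          ((B \ B').card : ℝ) ≤ ε * (Fintype.card G : ℝ) ∧
          ((C \ C').card : ℝ) ≤ ε * (Fintype.card G : ℝ) ∧
          ((D \ D').card : ℝ) ≤ ε * (Fintype.card G : ℝ) ∧
          ((E \ E').card : ℝ) ≤ ε * (Fintype.card G : ℝ) ∧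
          ∑ g ∈ E', repFn A' B' g * repFn C' D' g = 0 := by
  intro ε hε
  obtain ⟨η, hη, hremove⟩ := exists_removal_of_sum_repFn_le (ε := ε / 3) (by positivity)
  refine ⟨ε / 3 * η ^ 2, by positivity, fun G _ _ _ A B C D E h => ?_⟩
  have hN : (0 : ℝ) < Fintype.card G := by exact_mod_cast Fintype.card_pos
  have hrare : (#{g ∈ E | η * Fintype.card G < repFn A B g ∧
      η * Fintype.card G < repFn C D g} : ℝ) ≤ ε / 3 * Fintype.card G := by
    have := (card_mul_sq_le_sum_mul E (repFn A B) (repFn C D) (c := η * Fintype.card G)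
      (by positivity)).trans h
    refine le_of_mul_le_mul_right (this.trans_eq ?_)
      (by positivity : 0 < (η * Fintype.card G : ℝ) ^ 2)
    ring
  obtain ⟨A', hA', B', hB', E₁, hE₁, hA, hB, hE, hAB⟩ :=
    hremove G A B _ (sum_filter_le_card_mul E (repFn A B) hη.le)
  obtain ⟨C', hC', D', hD', E₂, hE₂, hC, hD, hF, hCD⟩ :=
    hremove G C D _ (sum_filter_le_card_mul E (repFn C D) hη.le)
  have hle : ε / 3 * (Fintype.card G : ℝ) ≤ ε * Fintype.card G := by gcongr; linarith
  refine ⟨A', B', C', D', E₁ ∪ E₂, hA', hB', hC', hD',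
    union_subset (hE₁.trans (filter_subset _ _)) (hE₂.trans (filter_subset _ _)),
    hA.trans hle, hB.trans hle, hC.trans hle, hD.trans hle, ?_, ?_⟩
  · have hsub : E \ (E₁ ∪ E₂) ⊆ ({g ∈ E | η * Fintype.card G < repFn A B g ∧
        η * Fintype.card G < repFn C D g} ∪
        ({g ∈ E | (repFn A B g : ℝ) ≤ η * Fintype.card G} \ E₁)) ∪
        ({g ∈ E | (repFn C D g : ℝ) ≤ η * Fintype.card G} \ E₂) := by
      intro g hg
      simp only [mem_union, mem_sdiff, mem_filter, not_or, ← not_le] at hg ⊢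
      tauto
    have hcard := (card_le_card hsub).trans ((card_union_le _ _).trans
      (Nat.add_le_add_right (card_union_le _ _) _))
    have hcard' := Nat.cast_le (α := ℝ).2 hcard
    push_cast at hcard'
    linarith
  · refine sum_eq_zero fun g hg => ?_
    rcases mem_union.1 hg with hg | hg
    · rw [repFn_eq_zero hAB hg, zero_mul]
    · rw [repFn_eq_zero hCD hg, mul_zero]
end

section
/- For every ε > 0 there exists δ > 0 such that the following holds. Let G be a finite group of order N and let A, E be subsets of G. If ∑_{g ∈ E} r_A(g)² ≤ δ·N³, then there exist subsets A′ ⊆ A and E′ ⊆ E with |A \ A′| ≤ ε·N and |E \ E′| ≤ ε·N such that (A′)² ∩ E′ = ∅, i.e., no element of E′ is a product of two elements of A′ (A′ is E′-product-free). -/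
open scoped Pointwise

open SimpleGraph SimpleGraph.TripartiteFromTriangles in
/-- The tripartite-from-triangles graph on `t` has at most `#t` triangles as soon as every
triangle of it comes from `t`. -/
theorem card_cliqueFinset_graph_le {α : Type*} [Fintype α] [DecidableEq α]
    {t : Finset (α × α × α)}
    (ht : ∀ x x' y y' z z', (x', y, z) ∈ t → (x, y', z) ∈ t → (x, y, z') ∈ t → (x, y, z) ∈ t) :
    ((graph t).cliqueFinset 3).card ≤ t.card := by
  refine le_trans (Finset.card_le_card ?_) (Finset.card_image_le
    (f := fun p : α × α × α =>
      ({.inl p.1, .inr (.inl p.2.1), .inr (.inr p.2.2)} : Finset (α ⊕ α ⊕ α))))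
  intro s hs
  rw [mem_cliqueFinset_iff, is3Clique_iff] at hs
  obtain ⟨a, b, c, hab, hac, hbc, rfl⟩ := hs
  obtain ⟨x, y, z, h, hxy, hxz, hyz⟩ := graph_triple hab hac hbc
  obtain ⟨z', hz⟩ := Graph.in₀₁_iff.1 hxy
  obtain ⟨y', hy⟩ := Graph.in₀₂_iff.1 hxz
  obtain ⟨x', hx⟩ := Graph.in₁₂_iff.1 hyz
  exact Finset.mem_image.2 ⟨(x, y, z), ht _ _ _ _ _ _ hx hy hz, h⟩

/-- If `f` is injective on a product, few fibres contain many points mapped into a set `R`. -/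
theorem card_heavy_fibers_mul_le {α β γ : Type*} [Fintype α] [Fintype β] [DecidableEq γ]
    {f : α → β → γ} (hf : Function.Injective2 f) (R : Finset γ) (c : ℝ) :
    ((Finset.univ.filter fun a =>
      c ≤ ((Finset.univ.filter fun b => f a b ∈ R).card : ℝ)).card : ℝ) * c ≤ R.card := by
  classical
  set H := Finset.univ.filter fun a => c ≤ ((Finset.univ.filter fun b => f a b ∈ R).card : ℝ)
  calc (H.card : ℝ) * c
      ≤ ∑ a ∈ H, ((Finset.univ.filter fun b => f a b ∈ R).card : ℝ) := by
        rw [← nsmul_eq_mul]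
        exact Finset.card_nsmul_le_sum _ _ _ fun a ha => (Finset.mem_filter.1 ha).2
    _ ≤ R.card := by
        rw [← Nat.cast_sum, ← Finset.card_sigma, Nat.cast_le]
        refine Finset.card_le_card_of_injOn (fun p => f p.1 p.2) ?_ ?_
        · intro p hp
          simpa using (Finset.mem_sigma.1 hp).2
        · rintro ⟨a, b⟩ - ⟨a', b'⟩ - h
          obtain ⟨rfl, rfl⟩ := hf h
          rfl

/-- Triples `(x, y, z)` such that `x⁻¹y` and `y⁻¹z` lie in `A` and `x⁻¹z` lies in `E`. -/
def productTriples {G : Type*} [Group G] [Fintype G] [DecidableEq G] (A E : Finset G) :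
    Finset (G × G × G) :=
  Finset.univ.filter fun p => p.1⁻¹ * p.2.1 ∈ A ∧ p.2.1⁻¹ * p.2.2 ∈ A ∧ p.1⁻¹ * p.2.2 ∈ E

theorem mem_productTriples {G : Type*} [Group G] [Fintype G] [DecidableEq G] {A E : Finset G}
    {x y z : G} :
    (x, y, z) ∈ productTriples A E ↔ x⁻¹ * y ∈ A ∧ y⁻¹ * z ∈ A ∧ x⁻¹ * z ∈ E := by
  simp [productTriples]

theorem card_productTriples_le {G : Type*} [Group G] [Fintype G] [DecidableEq G]
    (A E : Finset G) :
    (productTriples A E).card ≤ Fintype.card G * ∑ g ∈ E, repFn A A g := by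
  have hsum : ∑ g ∈ E, repFn A A g = ((A ×ˢ A).filter fun p => p.1 * p.2 ∈ E).card := by
    rw [Finset.card_eq_sum_card_fiberwise (f := fun p : G × G => p.1 * p.2) (t := E)
      (fun p hp => by simpa using (Finset.mem_filter.1 hp).2)]
    refine Finset.sum_congr rfl fun g hg => ?_
    rw [repFn, Finset.filter_filter]
    congr 1
    refine Finset.filter_congr fun p _ => ?_
    constructor
    · rintro rfl
      exact ⟨hg, rfl⟩
    · exact And.right
  rw [hsum, ← Finset.card_univ, ← Finset.card_product]
  refine Finset.card_le_card_of_injOn (fun p => (p.1, p.1⁻¹ * p.2.1, p.2.1⁻¹ * p.2.2)) ?_ ?_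
  · rintro ⟨x, y, z⟩ h
    obtain ⟨h₁, h₂, h₃⟩ := mem_productTriples.1 (Finset.mem_coe.1 h)
    simp [h₁, h₂, h₃, mul_assoc]
  · rintro ⟨x, y, z⟩ - ⟨x', y', z'⟩ - h
    simp only [Prod.mk.injEq] at h
    obtain ⟨rfl, h₁, h₂⟩ := h
    obtain rfl := mul_left_cancel h₁
    obtain rfl := mul_left_cancel h₂
    rfl

open SimpleGraph SimpleGraph.TripartiteFromTriangles in
theorem card_cliqueFinset_graph_productTriples_le {G : Type*} [Group G] [Fintype G]
    [DecidableEq G] (A E : Finset G) {δ : ℝ} (hδ : 0 ≤ δ)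
    (h : ((∑ g ∈ E, (repFn A A g) ^ 2 : ℕ) : ℝ) ≤ δ ^ 2 * (Fintype.card G : ℝ) ^ 3) :
    (((graph (productTriples A E)).cliqueFinset 3).card : ℝ) ≤ δ * (Fintype.card G : ℝ) ^ 3 := by
  have hclique : ((graph (productTriples A E)).cliqueFinset 3).card ≤
      Fintype.card G * ∑ g ∈ E, repFn A A g := by
    refine (card_cliqueFinset_graph_le ?_).trans (card_productTriples_le A E)
    intro x x' y y' z z'
    simp only [mem_productTriples]
    tauto
  have hsum : ((∑ g ∈ E, repFn A A g : ℕ) : ℝ) ≤ δ * (Fintype.card G : ℝ) ^ 2 := by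
    refine (sq_le_sq₀ (by positivity) (by positivity)).1 ?_
    calc ((∑ g ∈ E, repFn A A g : ℕ) : ℝ) ^ 2
        ≤ E.card * ((∑ g ∈ E, (repFn A A g) ^ 2 : ℕ) : ℝ) := by
          exact_mod_cast sq_sum_le_card_mul_sum_sq
      _ ≤ Fintype.card G * (δ ^ 2 * (Fintype.card G : ℝ) ^ 3) := by
          gcongr
          exact Finset.card_le_univ E
      _ = (δ * (Fintype.card G : ℝ) ^ 2) ^ 2 := by ring
  calc (((graph (productTriples A E)).cliqueFinset 3).card : ℝ)
      ≤ Fintype.card G * ((∑ g ∈ E, repFn A A g : ℕ) : ℝ) := by exact_mod_cast hclique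
    _ ≤ Fintype.card G * (δ * (Fintype.card G : ℝ) ^ 2) := by gcongr
    _ = δ * (Fintype.card G : ℝ) ^ 3 := by ring

/-- For every `ε > 0` there is a `δ > 0` such that for every finite group `G` of
order `N` and subsets `A, E ⊆ G`: if `∑_{g ∈ E} r_A(g)² ≤ δ·N³`, then there are
`A′ ⊆ A`, `E′ ⊆ E` with `|A \ A′| ≤ ε·N`, `|E \ E′| ≤ ε·N` and `(A′)² ∩ E′ = ∅`
(`A′` is `E′`-product-free). -/
theorem removal_product_free :
    ∀ ε : ℝ, 0 < ε → ∃ δ : ℝ, 0 < δ ∧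
      ∀ (G : Type) [Group G] [Fintype G] [DecidableEq G] (A E : Finset G),
        (((∑ g ∈ E, (repFn A A g) ^ 2 : ℕ) : ℝ) ≤ δ * (Fintype.card G : ℝ) ^ 3) →
        ∃ A' E' : Finset G,
          A' ⊆ A ∧ E' ⊆ E ∧
          ((A \ A').card : ℝ) ≤ ε * (Fintype.card G : ℝ) ∧
          ((E \ E').card : ℝ) ≤ ε * (Fintype.card G : ℝ) ∧
          (A' * A') ∩ E' = ∅ := by
  classical
  intro ε hε
  have hη : 0 < ε / 54 := by positivity
  have hB := SimpleGraph.triangleRemovalBound_pos hη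
  refine ⟨SimpleGraph.triangleRemovalBound (ε / 54) ^ 2, by positivity, ?_⟩
  intro G _ _ _ A E h
  have hN : (0 : ℝ) < Fintype.card G := by exact_mod_cast Fintype.card_pos
  have hcard : Fintype.card (G ⊕ G ⊕ G) = 3 * Fintype.card G := by
    simp only [Fintype.card_sum]
    ring
  set Γ := SimpleGraph.TripartiteFromTriangles.graph (productTriples A E)
  obtain ⟨Γ', hle, _, hedges, hfree⟩ := SimpleGraph.triangle_removal (G := Γ) (ε := ε / 54) (by
    refine (card_cliqueFinset_graph_productTriples_le A E hB.le h).trans_lt ?_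
    rw [hcard]
    push_cast
    have := mul_pos hB (pow_pos hN 3)
    linarith)
  set R := Γ.edgeFinset \ Γ'.edgeFinset with hRdef
  have hR : (R.card : ℝ) ≤ ε / 6 * (Fintype.card G : ℝ) ^ 2 := by
    rw [hRdef, Finset.cast_card_sdiff (SimpleGraph.edgeFinset_mono hle)]
    rw [hcard] at hedges
    push_cast at hedges
    linarith
  have adj_of {u v : G ⊕ G ⊕ G} (huv : Γ.Adj u v) (hn : s(u, v) ∉ R) : Γ'.Adj u v := by
    by_contra hc
    exact hn (by simp [hRdef, huv, hc])
  let f₀₁ : G → G → Sym2 (G ⊕ G ⊕ G) := fun g x => s(.inl x, .inr (.inl (x * g)))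
  let f₁₂ : G → G → Sym2 (G ⊕ G ⊕ G) := fun g x => s(.inr (.inl x), .inr (.inr (x * g)))
  let f₀₂ : G → G → Sym2 (G ⊕ G ⊕ G) := fun g x => s(.inl x, .inr (.inr (x * g)))
  have hf₀₁ : Function.Injective2 f₀₁ := by
    intro g g' x x' hx
    obtain ⟨rfl, hg⟩ : x = x' ∧ x * g = x' * g' := by simpa [f₀₁] using hx
    exact ⟨mul_left_cancel hg, rfl⟩
  have hf₁₂ : Function.Injective2 f₁₂ := by
    intro g g' x x' hx
    obtain ⟨rfl, hg⟩ : x = x' ∧ x * g = x' * g' := by simpa [f₁₂] using hx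
    exact ⟨mul_left_cancel hg, rfl⟩
  have hf₀₂ : Function.Injective2 f₀₂ := by
    intro g g' x x' hx
    obtain ⟨rfl, hg⟩ : x = x' ∧ x * g = x' * g' := by simpa [f₀₂] using hx
    exact ⟨mul_left_cancel hg, rfl⟩
  let removed (f : G → G → Sym2 (G ⊕ G ⊕ G)) (g : G) : Finset G :=
    Finset.univ.filter fun x => f g x ∈ R
  let heavy (f : G → G → Sym2 (G ⊕ G ⊕ G)) : Finset G :=
    Finset.univ.filter fun g => (Fintype.card G : ℝ) / 3 ≤ (removed f g).card
  have card_heavy {f : G → G → Sym2 (G ⊕ G ⊕ G)} (hf : Function.Injective2 f) :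
      ((heavy f).card : ℝ) ≤ ε / 2 * Fintype.card G := by
    have h₁ : ((heavy f).card : ℝ) * ((Fintype.card G : ℝ) / 3) ≤ R.card :=
      card_heavy_fibers_mul_le hf R _
    refine le_of_mul_le_mul_right (h₁.trans (hR.trans_eq ?_))
      (by positivity : (0 : ℝ) < Fintype.card G / 3)
    ring
  have card_removed {f : G → G → Sym2 (G ⊕ G ⊕ G)} {g : G} (hg : g ∉ heavy f) :
      ((removed f g).card : ℝ) < Fintype.card G / 3 := by
    simpa [heavy] using hg
  refine ⟨A \ (heavy f₀₁ ∪ heavy f₁₂), E \ heavy f₀₂, Finset.sdiff_subset, Finset.sdiff_subset,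
    ?_, ?_, ?_⟩
  · have h₁ : (A \ (A \ (heavy f₀₁ ∪ heavy f₁₂))).card ≤ (heavy f₀₁).card + (heavy f₁₂).card := by
      refine (Finset.card_le_card ?_).trans (Finset.card_union_le _ _)
      rw [sdiff_sdiff_right_self, Finset.inf_eq_inter]
      exact Finset.inter_subset_right
    have h₂ := card_heavy hf₀₁
    have h₃ := card_heavy hf₁₂
    have h₄ : ((A \ (A \ (heavy f₀₁ ∪ heavy f₁₂))).card : ℝ) ≤
      (heavy f₀₁).card + (heavy f₁₂).card := by exact_mod_cast h₁
    linarith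
  · have h₁ : (E \ (E \ heavy f₀₂)).card ≤ (heavy f₀₂).card := by
      rw [sdiff_sdiff_right_self, Finset.inf_eq_inter]
      exact Finset.card_le_card Finset.inter_subset_right
    have h₂ := card_heavy hf₀₂
    have h₃ : ((E \ (E \ heavy f₀₂)).card : ℝ) ≤ (heavy f₀₂).card := by exact_mod_cast h₁
    have := mul_pos hε hN
    linarith
  · rw [Finset.eq_empty_iff_forall_notMem]
    intro e he
    obtain ⟨hmul, heE⟩ := Finset.mem_inter.1 he
    obtain ⟨a, ha, b, hb, rfl⟩ := Finset.mem_mul.1 hmul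
    simp only [Finset.mem_sdiff, Finset.mem_union, not_or] at ha hb heE
    obtain ⟨x, hx⟩ : ∃ x, x ∉ removed f₀₁ a ∪
        ((removed f₁₂ b).image (· * a⁻¹) ∪ removed f₀₂ (a * b)) := by
      by_contra! hall
      have hcov := (Finset.card_le_card fun x _ => hall x : (Finset.univ : Finset G).card ≤ _)
      have h₁ := hcov.trans ((Finset.card_union_le _ _).trans
        (Nat.add_le_add_left ((Finset.card_union_le _ _).trans
          (Nat.add_le_add_right Finset.card_image_le _)) _))
      rw [Finset.card_univ] at h₁
      have h₂ : (Fintype.card G : ℝ) ≤ (removed f₀₁ a).card +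
        ((removed f₁₂ b).card + (removed f₀₂ (a * b)).card) := by exact_mod_cast h₁
      have h₃ := card_removed ha.2.1
      have h₄ := card_removed hb.2.2
      have h₅ := card_removed heE.2
      linarith
    simp only [Finset.mem_union, not_or] at hx
    obtain ⟨hx₀₁, hx₁₂, hx₀₂⟩ := hx
    replace hx₁₂ : x * a ∉ removed f₁₂ b := fun hc =>
      hx₁₂ (Finset.mem_image.2 ⟨x * a, hc, by simp⟩)
    have ht : (x, x * a, x * (a * b)) ∈ productTriples A E := by
      simp [mem_productTriples, ha.1, hb.1, heE.1, mul_assoc]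
    refine hfree _ (SimpleGraph.is3Clique_triple_iff.2
      ⟨adj_of (u := .inl x) (v := .inr (.inl (x * a))) (.in₀₁ ht) ?_,
        adj_of (v := .inr (.inr (x * (a * b)))) (.in₀₂ ht) ?_, adj_of (.in₁₂ ht) ?_⟩)
    · simpa [removed, f₀₁] using hx₀₁
    · simpa [removed, f₀₂] using hx₀₂
    · simpa [removed, f₁₂, mul_assoc] using hx₁₂
end

section
/- For every ε > 0 there exists δ > 0 such that the following holds. Let G be a finite group of order N and let A be a subset of G. If ∑_{g ∈ G \ A} r_A(g)² ≤ δ·N³, then there exists a subset A′ ⊆ A with |A \ A′| ≤ ε·N such that |(A′)²| ≤ |A′| + ε·N (A′ has small doubling). -/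
open scoped Pointwise

open Finset SimpleGraph SimpleGraph.TripartiteFromTriangles

section GroupRemoval

variable {G : Type*} [Group G]

/-- The embedding sending `(x, a, b)` to the partial products `(x, x * a, x * a * b)`. -/
@[simps]
def partialProducts : G × G × G ↪ G × G × G where
  toFun p := (p.1, p.1 * p.2.1, p.1 * p.2.1 * p.2.2)
  inj' := by
    rintro ⟨x, a, b⟩ ⟨y, c, d⟩ h
    simp only [Prod.mk.injEq] at h
    obtain ⟨rfl, h, h'⟩ := h
    obtain rfl := mul_left_cancel h
    obtain rfl := mul_left_cancel h'
    rfl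

/-- The triangle indices `(x, x * a, x * a * b)` for `x : G` and `(a, b) ∈ M`. -/
def mulTriangleIndices [Fintype G] (M : Finset (G × G)) : Finset (G × G × G) :=
  (univ ×ˢ M).map partialProducts

lemma mem_mulTriangleIndices [Fintype G] {M : Finset (G × G)} {x y z : G} :
    (x, y, z) ∈ mulTriangleIndices M ↔ (x⁻¹ * y, y⁻¹ * z) ∈ M := by
  simp only [mulTriangleIndices, mem_map, mem_product, mem_univ, true_and,
    partialProducts_apply, Prod.mk.injEq, Prod.exists]
  constructor
  · rintro ⟨x, a, b, h, rfl, rfl, rfl⟩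
    simpa [mul_assoc] using h
  · exact fun h => ⟨x, _, _, h, by simp⟩

lemma card_mulTriangleIndices [Fintype G] (M : Finset (G × G)) :
    #(mulTriangleIndices M) = Fintype.card G * #M := by
  simp [mulTriangleIndices]

/-- A set of pairs is a product matching if no two of its elements agree in the first coordinate,
in the second coordinate, or in the product of the coordinates. -/
structure IsProductMatching (M : Finset (G × G)) : Prop where
  injOn_fst : Set.InjOn Prod.fst (M : Set (G × G))
  injOn_snd : Set.InjOn Prod.snd (M : Set (G × G))
  injOn_mul : Set.InjOn (fun p : G × G => p.1 * p.2) (M : Set (G × G))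

lemma IsProductMatching.explicitDisjoint [Fintype G] {M : Finset (G × G)}
    (hM : IsProductMatching M) : ExplicitDisjoint (mulTriangleIndices M) where
  inj₀ x y z x' h h' := by
    rw [mem_mulTriangleIndices] at h h'
    simpa using hM.injOn_snd h h' rfl
  inj₁ x y z y' h h' := by
    rw [mem_mulTriangleIndices] at h h'
    simpa using hM.injOn_mul h h' (by simp [mul_assoc])
  inj₂ x y z z' h h' := by
    rw [mem_mulTriangleIndices] at h h'
    simpa using hM.injOn_fst h h' rfl

/-- The pairs in `A × B` whose product lies in `C`. -/
def mulSolutions [DecidableEq G] (A B C : Finset G) : Finset (G × G) :=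
  {p ∈ A ×ˢ B | p.1 * p.2 ∈ C}

lemma mem_mulSolutions [DecidableEq G] {A B C : Finset G} {p : G × G} :
    p ∈ mulSolutions A B C ↔ p.1 ∈ A ∧ p.2 ∈ B ∧ p.1 * p.2 ∈ C := by
  simp [mulSolutions, and_assoc]

lemma card_cliqueFinset_mulTriangleIndices_le [Fintype G] [DecidableEq G] {A B C : Finset G}
    {M : Finset (G × G)} (hM : M ⊆ mulSolutions A B C) :
    #((graph (mulTriangleIndices M)).cliqueFinset 3) ≤
      Fintype.card G * #(mulSolutions A B C) := by
  rw [← card_mulTriangleIndices]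
  refine (card_le_card fun s hs => ?_).trans (card_map (f := toTriangle)).le
  rw [mem_cliqueFinset_iff, is3Clique_iff] at hs
  obtain ⟨u, v, w, huv, huw, hvw, rfl⟩ := hs
  obtain ⟨x, y, z, hs, hxy, hxz, hyz⟩ := graph_triple huv huw hvw
  rw [Graph.in₀₁_iff] at hxy
  rw [Graph.in₀₂_iff] at hxz
  rw [Graph.in₁₂_iff] at hyz
  obtain ⟨z', hxy⟩ := hxy
  obtain ⟨y', hxz⟩ := hxz
  obtain ⟨x', hyz⟩ := hyz
  rw [mem_mulTriangleIndices] at hxy hxz hyz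
  have ha := (mem_mulSolutions.1 (hM hxy)).1
  have hb := (mem_mulSolutions.1 (hM hyz)).2.1
  have hc := (mem_mulSolutions.1 (hM hxz)).2.2
  refine mem_map.2 ⟨(x, y, z), mem_mulTriangleIndices.2 (mem_mulSolutions.2 ⟨ha, hb, ?_⟩), hs⟩
  simpa [mul_assoc] using hc

/-- If `A × B` has few pairs with product in `C`, then every product matching among these pairs
is small. -/
lemma IsProductMatching.card_le [Fintype G] [DecidableEq G] {η : ℝ} (hη : 0 < η)
    {A B C : Finset G}
    (hS : (#(mulSolutions A B C) : ℝ) ≤ triangleRemovalBound (η / 9) * (Fintype.card G : ℝ) ^ 2)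
    {M : Finset (G × G)} (hM : IsProductMatching M) (hMS : M ⊆ mulSolutions A B C) :
    (#M : ℝ) ≤ η * Fintype.card G := by
  by_contra! h
  have := hM.explicitDisjoint
  have hN : (0 : ℝ) < Fintype.card G := by exact_mod_cast Fintype.card_pos
  have hfar : (graph (mulTriangleIndices M)).FarFromTriangleFree (η / 9) := by
    refine farFromTriangleFree _ ?_
    rw [card_mulTriangleIndices]
    push_cast
    nlinarith
  have hmany := hfar.le_card_cliqueFinset
  have hfew : (#((graph (mulTriangleIndices M)).cliqueFinset 3) : ℝ) ≤
      Fintype.card G * #(mulSolutions A B C) := by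
    exact_mod_cast card_cliqueFinset_mulTriangleIndices_le hMS
  have hpos : 0 < triangleRemovalBound (η / 9) := triangleRemovalBound_pos (by positivity)
  have hle := mul_le_mul_of_nonneg_left hS hN.le
  simp only [Fintype.card_sum, Nat.cast_add] at hmany
  have : 0 < triangleRemovalBound (η / 9) * (Fintype.card G : ℝ) ^ 3 := by positivity
  nlinarith

/-- Every finite set of pairs contains a product matching that meets each of its elements. -/
lemma exists_isProductMatching_forall [DecidableEq G] (S : Finset (G × G)) :
    ∃ M ⊆ S, IsProductMatching M ∧ ∀ p ∈ S,
      p.1 ∈ M.image Prod.fst ∨ p.2 ∈ M.image Prod.snd ∨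
        p.1 * p.2 ∈ M.image (fun q => q.1 * q.2) := by
  classical
  obtain ⟨M, hM, hmax⟩ := exists_max_image {M ∈ S.powerset | IsProductMatching M} card
    ⟨∅, by simp only [mem_filter, mem_powerset, empty_subset, true_and]; constructor <;> simp⟩
  simp only [mem_filter, mem_powerset] at hM hmax
  refine ⟨M, hM.1, hM.2, fun p hp => ?_⟩
  by_contra! h
  have hpM : p ∉ M := fun hpM => h.1 (mem_image_of_mem _ hpM)
  have hins : IsProductMatching (insert p M) := by
    have hpM' : p ∉ (M : Set (G × G)) := hpM
    obtain ⟨h₁, h₂, h₃⟩ := h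
    constructor <;> rw [coe_insert, Set.injOn_insert hpM', ← coe_image, mem_coe]
    exacts [⟨hM.2.injOn_fst, h₁⟩, ⟨hM.2.injOn_snd, h₂⟩, ⟨hM.2.injOn_mul, h₃⟩]
  have := hmax _ ⟨insert_subset hp hM.1, hins⟩
  rw [card_insert_of_notMem hpM] at this
  omega

lemma sum_repFn_eq_card_mulSolutions [DecidableEq G] (A B C : Finset G) :
    ∑ g ∈ C, repFn A B g = #(mulSolutions A B C) := by
  rw [card_eq_sum_card_fiberwise (f := fun p => p.1 * p.2) (t := C)
    fun p hp => (mem_mulSolutions.1 hp).2.2]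
  refine sum_congr rfl fun g hg => congrArg card ?_
  ext p
  simp only [mem_filter, mem_product, mem_mulSolutions]
  grind

lemma card_mulSolutions_sq_le [Fintype G] [DecidableEq G] (A B C : Finset G) :
    #(mulSolutions A B C) ^ 2 ≤ Fintype.card G * ∑ g ∈ C, repFn A B g ^ 2 := by
  rw [← sum_repFn_eq_card_mulSolutions]
  refine sq_sum_le_card_mul_sum_sq.trans ?_
  gcongr
  exact card_le_univ C

end GroupRemoval

/-- For every `ε > 0` there is a `δ > 0` such that for every finite group `G` of
order `N` and a subset `A ⊆ G`: if `∑_{g ∈ G \ A} r_A(g)² ≤ δ·N³`, then there is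
`A′ ⊆ A` with `|A \ A′| ≤ ε·N` and `|(A′)²| ≤ |A′| + ε·N` (`A′` has small
doubling). -/
theorem removal_small_doubling :
    ∀ ε : ℝ, 0 < ε → ∃ δ : ℝ, 0 < δ ∧
      ∀ (G : Type) [Group G] [Fintype G] [DecidableEq G] (A : Finset G),
        (((∑ g ∈ Finset.univ \ A, (repFn A A g) ^ 2 : ℕ) : ℝ)
            ≤ δ * (Fintype.card G : ℝ) ^ 3) →
        ∃ A' : Finset G,
          A' ⊆ A ∧
          ((A \ A').card : ℝ) ≤ ε * (Fintype.card G : ℝ) ∧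
          ((A' * A').card : ℝ) ≤ (A'.card : ℝ) + ε * (Fintype.card G : ℝ) := by
  intro ε hε
  have hη : 0 < ε / 3 := by positivity
  have hc : 0 < triangleRemovalBound (ε / 3 / 9) := triangleRemovalBound_pos (by positivity)
  refine ⟨triangleRemovalBound (ε / 3 / 9) ^ 2, by positivity, fun G _ _ _ A hA => ?_⟩
  have hS : (#(mulSolutions A A (univ \ A)) : ℝ) ≤
      triangleRemovalBound (ε / 3 / 9) * (Fintype.card G : ℝ) ^ 2 := by
    refine le_of_sq_le_sq ?_ (by positivity)
    calc (#(mulSolutions A A (univ \ A)) : ℝ) ^ 2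
        ≤ Fintype.card G * ((∑ g ∈ univ \ A, repFn A A g ^ 2 : ℕ) : ℝ) := by
          exact_mod_cast card_mulSolutions_sq_le A A (univ \ A)
      _ ≤ Fintype.card G *
          (triangleRemovalBound (ε / 3 / 9) ^ 2 * (Fintype.card G : ℝ) ^ 3) := by gcongr
      _ = _ := by ring
  obtain ⟨M, hMS, hM, hmax⟩ := exists_isProductMatching_forall (mulSolutions A A (univ \ A))
  have hcard := hM.card_le hη hS hMS
  have h₁ : #(M.image Prod.fst) ≤ #M := card_image_le
  have h₂ : #(M.image Prod.snd) ≤ #M := card_image_le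
  have h₃ : #(M.image fun q => q.1 * q.2) ≤ #M := card_image_le
  have h₁₂ := card_union_le (M.image Prod.fst) (M.image Prod.snd)
  refine ⟨A \ (M.image Prod.fst ∪ M.image Prod.snd), sdiff_subset, ?_, ?_⟩
  · have hle : #(A \ (A \ (M.image Prod.fst ∪ M.image Prod.snd))) ≤ 2 * #M := by
      refine (card_le_card fun x hx => ?_).trans (h₁₂.trans (by omega))
      simp only [mem_sdiff] at hx
      tauto
    have hle' : (#(A \ (A \ (M.image Prod.fst ∪ M.image Prod.snd))) : ℝ) ≤ 2 * #M := by
      exact_mod_cast hle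
    have : (0 : ℝ) ≤ ε * Fintype.card G := by positivity
    linarith
  · set A' := A \ (M.image Prod.fst ∪ M.image Prod.snd) with hA'
    have hsub : A' * A' ⊆ A' ∪ (M.image Prod.fst ∪ M.image Prod.snd ∪
        M.image fun q => q.1 * q.2) := by
      intro g hg
      obtain ⟨a, ha, b, hb, rfl⟩ := mem_mul.1 hg
      rw [hA', mem_sdiff, mem_union, not_or] at ha hb
      by_cases hab : a * b ∈ A
      · simp only [hA', mem_union, mem_sdiff]
        tauto
      · have := hmax (a, b) (mem_mulSolutions.2 ⟨ha.1, hb.1, by simpa using hab⟩)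
        rw [mem_union, mem_union]
        tauto
    have hle : #(A' * A') ≤ #A' + 3 * #M := by
      have h := card_union_le A' (M.image Prod.fst ∪ M.image Prod.snd ∪
        M.image fun q => q.1 * q.2)
      have h' := card_union_le (M.image Prod.fst ∪ M.image Prod.snd) (M.image fun q => q.1 * q.2)
      have := card_le_card hsub
      omega
    have hle' : (#(A' * A') : ℝ) ≤ #A' + 3 * #M := by exact_mod_cast hle
    linarith
end
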